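/- arXiv:2101.09481 — 7 statements merged into one kernel-verified Lean document; each statement's English description precedes it below -/
import Mathlib

section
/- Let H ∈ ℂ[x₁,…,xₙ] be a nonconstant homogeneous polynomial that is not a proper power, and let P ∈ ℂ[x₁,…,xₙ] be a homogeneous polynomial such that [H,P] = 0. Then there exist a ∈ ℂ and k ∈ ℕ such that P = a·H^k. Moreover, if P is homogeneous of degree m and deg H does not divide m, then P = 0. -/
open MvPolynomial

/-- A nonconstant homogeneous polynomial `h` is *not a proper power* if it cannot be
written as `b • g ^ k` with `g` homogeneous of degree strictly smaller than `deg h`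
and `k ≥ 2`. -/
def NotProperPower {n : ℕ} (h : MvPolynomial (Fin n) ℂ) : Prop :=
  ¬ ∃ (b : ℂ) (g : MvPolynomial (Fin n) ℂ) (k m : ℕ),
      2 ≤ k ∧ g.IsHomogeneous m ∧ m < h.totalDegree ∧ h = b • g ^ k

/-- The Poisson bracket `[f,g]` vanishes, i.e. all Jacobian minors vanish. -/
def PoissonCommute {n : ℕ} (f g : MvPolynomial (Fin n) ℂ) : Prop :=
  ∀ p q : Fin n, pderiv p f * pderiv q g = pderiv q f * pderiv p g

theorem aux_coeff {n : ℕ} (A : MvPolynomial (Fin n) ℂ) (q : Fin n) (s : Fin n →₀ ℕ) :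
    coeff s (X q * pderiv q A) = (s q : ℂ) * coeff s A := by
  classical
  induction A using MvPolynomial.induction_on' with
  | add p r hp hr => rw [map_add, mul_add, coeff_add, coeff_add, hp, hr]; ring
  | monomial t a =>
    rw [X_mul_pderiv_monomial, coeff_smul, coeff_monomial]
    split_ifs with h
    · subst h; simp
    · simp

/-- Polynomials with equal logarithmic derivatives are proportional. -/
theorem aux_prop {n : ℕ} (A B : MvPolynomial (Fin n) ℂ) (hB : B ≠ 0)
    (h : ∀ q, A * pderiv q B = B * pderiv q A) : ∃ c : ℂ, A = c • B := by
  classical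
  let o : MonomialOrder (Fin n) := MonomialOrder.lex
  have hlb : coeff (o.degree B) B ≠ 0 := o.leadingCoeff_ne_zero_iff.mpr hB
  refine ⟨coeff (o.degree B) A / coeff (o.degree B) B, ?_⟩
  set c := coeff (o.degree B) A / coeff (o.degree B) B with hc
  by_contra hne
  have hD : A - c • B ≠ 0 := sub_ne_zero.mpr hne
  have hD0 : coeff (o.degree B) (A - c • B) = 0 := by
    rw [coeff_sub, coeff_smul, hc, smul_eq_mul]; field_simp; ring
  have hDr : ∀ q, (A - c • B) * pderiv q B = B * pderiv q (A - c • B) := by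
    intro q
    rw [map_sub, Derivation.map_smul, sub_mul, h q, smul_eq_C_mul, smul_eq_C_mul]; ring
  generalize A - c • B = D at hD hD0 hDr
  have hld : coeff (o.degree D) D ≠ 0 := o.leadingCoeff_ne_zero_iff.mpr hD
  have hdeg : ∀ (F : MvPolynomial (Fin n) ℂ) (q : Fin n),
      o.toSyn (o.degree (X q * pderiv q F)) ≤ o.toSyn (o.degree F) := by
    intro F q
    rw [MonomialOrder.degree_le_iff]
    intro b hb
    apply o.le_degree
    rw [mem_support_iff] at hb ⊢
    rw [aux_coeff] at hb
    exact right_ne_zero_of_mul hb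
  have hE : o.degree D = o.degree B := by
    ext q
    have e : D * (X q * pderiv q B) = (X q * pderiv q D) * B := by
      linear_combination X q * hDr q
    have e2 := congrArg (coeff (o.degree D + o.degree B)) e
    rw [o.coeff_mul_of_add_of_degree_le le_rfl (hdeg B q),
      o.coeff_mul_of_add_of_degree_le (hdeg D q) le_rfl, aux_coeff, aux_coeff] at e2
    have e3 : (coeff (o.degree D) D * coeff (o.degree B) B) *
      (((o.degree D) q : ℂ) - ((o.degree B) q : ℂ)) = 0 := by linear_combination -e2
    have e4 := (mul_eq_zero.mp e3).resolve_left (mul_ne_zero hld hlb)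
    exact_mod_cast sub_eq_zero.mp e4
  rw [hE] at hld
  exact hld hD0

theorem aux_root {n : ℕ} (A B : MvPolynomial (Fin n) ℂ) (a b : ℕ) (ha : 0 < a)
    (hab : a.Coprime b) (h : A ^ a = B ^ b) : ∃ R, B = R ^ a := by
  let K := FractionRing (MvPolynomial (Fin n) ℂ)
  have h' : (algebraMap _ K A) ^ a = (algebraMap _ K B) ^ b := by
    rw [← map_pow, ← map_pow, h]
  obtain ⟨c, -, hc⟩ := (pow_eq_pow_iff_of_coprime hab).mp h'
  obtain ⟨R, rfl⟩ := IsIntegrallyClosed.exists_algebraMap_eq_of_isIntegral_pow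
    (R := MvPolynomial (Fin n) ℂ) (x := c) ha (hc ▸ isIntegral_algebraMap)
  refine ⟨R, IsFractionRing.injective (MvPolynomial (Fin n) ℂ) K ?_⟩
  rw [hc, map_pow]

theorem aux_hom {n : ℕ} (R : MvPolynomial (Fin n) ℂ) (a e : ℕ) (ha : 0 < a)
    (h : (R ^ a).IsHomogeneous (a * e)) : R.IsHomogeneous e := by
  by_cases hR : R = 0
  · subst hR; exact isHomogeneous_zero _ _ _
  have hE := h.sum_X_mul_pderiv
  have hE2 : ∑ q, X q * pderiv q R = (e : MvPolynomial (Fin n) ℂ) * R := by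
    have h1 : ((a : MvPolynomial (Fin n) ℂ) * R ^ (a - 1)) * ∑ q, X q * pderiv q R
        = (a * R ^ (a - 1)) * (e * R) := by
      rw [Finset.mul_sum]
      calc _ = ∑ q, X q * pderiv q (R ^ a) := by
            refine Finset.sum_congr rfl fun q _ => ?_
            rw [pderiv_pow]; ring
        _ = _ := by
            rw [hE, nsmul_eq_mul]
            obtain ⟨k, rfl⟩ : ∃ k, a = k + 1 := ⟨a - 1, by omega⟩
            push_cast
            ring
    refine mul_left_cancel₀ (mul_ne_zero ?_ (pow_ne_zero _ hR)) h1
    exact_mod_cast ha.ne'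
  intro s hs
  have h2 := congrArg (coeff s) hE2
  rw [coeff_sum] at h2
  simp only [aux_coeff] at h2
  rw [← Finset.sum_mul, ← nsmul_eq_mul, coeff_smul, nsmul_eq_mul] at h2
  have h3 := mul_right_cancel₀ hs h2
  rw [Finsupp.weight_apply, Finsupp.sum_fintype _ _ (by simp)]
  simp only [Pi.one_apply, smul_eq_mul, mul_one]
  exact_mod_cast h3

theorem stmt_0 {n : ℕ} (H P : MvPolynomial (Fin n) ℂ) (dH : ℕ)
    (hHhom : H.IsHomogeneous dH) (hHnc : H.totalDegree ≠ 0)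
    (hHnp : NotProperPower H)
    (m : ℕ) (hPhom : P.IsHomogeneous m)
    (hbr : PoissonCommute H P) :
    (∃ (a : ℂ) (k : ℕ), P = a • H ^ k) ∧ (¬ H.totalDegree ∣ m → P = 0) := by
  by_cases hP : P = 0
  · exact ⟨⟨0, 0, by simp [hP]⟩, fun _ => hP⟩
  have hH : H ≠ 0 := by rintro rfl; simp at hHnc
  have hd : H.totalDegree = dH := hHhom.totalDegree hH
  rw [hd] at hHnc ⊢
  obtain ⟨g, a, b, hg, hab, hda, hmb⟩ : ∃ g a b : ℕ, 0 < g ∧ a.Coprime b ∧ dH = a * g ∧ m = b * g := by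
    obtain ⟨a, b, h1, h2, h3⟩ := Nat.exists_coprime dH m
    exact ⟨_, a, b, Nat.gcd_pos_of_pos_left _ (by omega), h1, h2, h3⟩
  have ha : 0 < a := Nat.pos_of_ne_zero (by rintro rfl; simp at hda; exact hHnc hda)
  have hgne : (g : MvPolynomial (Fin n) ℂ) ≠ 0 := by exact_mod_cast hg.ne'
  have key : ∀ q, (a : MvPolynomial (Fin n) ℂ) * H * pderiv q P = b * P * pderiv q H := by
    intro q
    have e1 := hHhom.sum_X_mul_pderiv
    have e2 := hPhom.sum_X_mul_pderiv
    rw [nsmul_eq_mul] at e1 e2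
    have e3 : (∑ p, X p * pderiv p H) * pderiv q P = (∑ p, X p * pderiv p P) * pderiv q H := by
      rw [Finset.sum_mul, Finset.sum_mul]
      refine Finset.sum_congr rfl fun p _ => ?_
      linear_combination X p * hbr p q
    rw [e1, e2, hda, hmb] at e3
    push_cast at e3
    apply mul_left_cancel₀ hgne
    linear_combination e3
  obtain ⟨c, hc⟩ := aux_prop (P ^ a) (H ^ b) (pow_ne_zero _ hH) (by
    intro q
    apply mul_left_cancel₀ hH
    obtain ⟨k, rfl⟩ : ∃ k, a = k + 1 := ⟨a - 1, by omega⟩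
    have kq := key q
    rw [pderiv_pow, pderiv_pow]
    rcases b with _ | l
    · push_cast at *
      linear_combination -P ^ k * kq
    · push_cast at *
      linear_combination -P ^ k * H ^ (l + 1) * kq)
  have ha1 : a = 1 := by
    by_contra hne
    have hc0 : c ≠ 0 := by
      rintro rfl
      rw [zero_smul] at hc
      exact pow_ne_zero _ hP hc
    obtain ⟨γ, hγ⟩ := IsAlgClosed.exists_pow_nat_eq c⁻¹ ha
    obtain ⟨R, hR⟩ := aux_root (γ • P) H a b ha hab (by
      rw [smul_pow, hγ, hc, smul_smul, inv_mul_cancel₀ hc0, one_smul])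
    refine hHnp ⟨1, R, a, g, by omega, aux_hom R a g ha ?_, ?_, by rw [one_smul, hR]⟩
    · rw [← hR, ← hda]; exact hHhom
    · rw [hd, hda]; nlinarith [show 2 ≤ a by omega]
  subst ha1
  refine ⟨⟨c, b, by simpa using hc⟩, fun hnd => (hnd ?_).elim⟩
  exact ⟨b, by rw [hmb, hda]; ring⟩
end

section
/- Let H ∈ ℂ[x₁,…,xₙ] be a nonconstant homogeneous polynomial that is not a proper power, and let P ∈ ℂ[x₁,…,xₙ] be any polynomial such that [H,P] = 0. Then P belongs to the subalgebra ℂ[H], i.e. there exists a univariate polynomial Q ∈ ℂ[T] with P = Q(H). -/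
open MvPolynomial

lemma coeff_theta {n : ℕ} (i : Fin n) (F : MvPolynomial (Fin n) ℂ) (s : Fin n →₀ ℕ) :
    coeff s (X i * pderiv i F) = (s i : ℂ) * coeff s F := by
  classical
  induction F using MvPolynomial.induction_on' with
  | monomial m r =>
    rw [X_mul_pderiv_monomial, coeff_smul, coeff_monomial]
    split_ifs with h
    · subst h; simp
    · simp
  | add p q hp hq =>
    rw [map_add, mul_add, coeff_add, coeff_add, hp, hq]; ring

lemma degree_theta_le {n : ℕ} (i : Fin n) (F : MvPolynomial (Fin n) ℂ) (m : MonomialOrder (Fin n)) :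
    m.toSyn (m.degree (X i * pderiv i F)) ≤ m.toSyn (m.degree F) := by
  rw [m.degree_le_iff]
  intro c hc
  apply m.le_degree
  rw [mem_support_iff, coeff_theta] at hc
  rw [mem_support_iff]
  exact right_ne_zero_of_mul hc

lemma uniq_sol {n : ℕ} (F G : MvPolynomial (Fin n) ℂ) (hG : G ≠ 0)
    (h : ∀ i, G * pderiv i F = F * pderiv i G) : ∃ c : ℂ, F = C c * G := by
  let o : MonomialOrder (Fin n) := MonomialOrder.lex
  have hGm : coeff (o.degree G) G ≠ 0 := o.coeff_degree_ne_zero_iff.mpr hG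
  refine ⟨coeff (o.degree G) F / coeff (o.degree G) G, ?_⟩
  set c := coeff (o.degree G) F / coeff (o.degree G) G with hc
  by_contra hne
  set K := F - C c * G with hK
  have hK0 : K ≠ 0 := sub_ne_zero.mpr hne
  have hKm : coeff (o.degree K) K ≠ 0 := o.coeff_degree_ne_zero_iff.mpr hK0
  have hz : coeff (o.degree G) K = 0 := by
    rw [hK, coeff_sub, coeff_C_mul, hc]; field_simp; ring
  have hmm : o.degree K ≠ o.degree G := by
    intro h1; rw [h1] at hKm; exact hKm hz
  obtain ⟨i, hi⟩ : ∃ i, o.degree K i ≠ o.degree G i := by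
    by_contra hcon; push Not at hcon; exact hmm (Finsupp.ext hcon)
  have e1 : G * (X i * pderiv i K) = (X i * pderiv i G) * K := by
    rw [hK, map_sub, pderiv_C_mul]
    linear_combination X i * h i
  have e2 := congrArg (coeff (o.degree G + o.degree K)) e1
  rw [o.coeff_mul_of_add_of_degree_le le_rfl (degree_theta_le i K o),
    o.coeff_mul_of_add_of_degree_le (degree_theta_le i G o) le_rfl, coeff_theta, coeff_theta] at e2
  have e3 : ((o.degree K i : ℂ) - o.degree G i) * (coeff (o.degree G) G * coeff (o.degree K) K) = 0 := by
    linear_combination e2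
  rcases mul_eq_zero.mp e3 with h4 | h4
  · exact hi (by exact_mod_cast sub_eq_zero.mp h4)
  · exact mul_ne_zero hGm hKm h4

lemma hom_mul {n : ℕ} {a : ℕ} (A B : MvPolynomial (Fin n) ℂ) (hA : A.IsHomogeneous a) (j : ℕ) :
    homogeneousComponent (a + j) (A * B) = A * homogeneousComponent j B := by
  conv_lhs => rw [← sum_homogeneousComponent B, Finset.mul_sum, map_sum]
  have : ∀ i, homogeneousComponent (a + j) (A * homogeneousComponent i B) =
      if i = j then A * homogeneousComponent j B else 0 := by
    intro i
    rw [homogeneousComponent_of_mem (hA.mul (homogeneousComponent_isHomogeneous i B))]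
    by_cases h : i = j
    · subst h; simp
    · rw [if_neg h, if_neg (by omega)]
  simp_rw [this]
  rw [Finset.sum_ite_eq']
  split_ifs with h
  · rfl
  · rw [homogeneousComponent_eq_zero _ _ (by simpa using h), mul_zero]

lemma hom_pderiv {n : ℕ} (B : MvPolynomial (Fin n) ℂ) (i : Fin n) (j : ℕ) :
    homogeneousComponent j (pderiv i B) = pderiv i (homogeneousComponent (j+1) B) := by
  ext s
  rw [coeff_homogeneousComponent, coeff_pderiv, coeff_pderiv, coeff_homogeneousComponent]
  simp [ite_mul]

lemma comm_component {n : ℕ} {H P : MvPolynomial (Fin n) ℂ} {d : ℕ} (hH : H.IsHomogeneous d)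
    (h : PoissonCommute H P) (j : ℕ) : PoissonCommute H (homogeneousComponent j P) := by
  intro p q
  rcases j with _ | j
  · simp [homogeneousComponent_zero]
  · rw [← hom_pderiv, ← hom_pderiv, ← hom_mul _ _ (hH.pderiv), ← hom_mul _ _ (hH.pderiv), h p q]

lemma euler_rel {n : ℕ} {H P : MvPolynomial (Fin n) ℂ} {d e : ℕ} (hH : H.IsHomogeneous d)
    (hP : P.IsHomogeneous e) (h : PoissonCommute H P) (p : Fin n) :
    pderiv p H * ((e : MvPolynomial (Fin n) ℂ) * P) = (d : MvPolynomial (Fin n) ℂ) * H * pderiv p P := by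
  have h1 := hH.sum_X_mul_pderiv
  have h2 := hP.sum_X_mul_pderiv
  rw [nsmul_eq_mul] at h1 h2
  rw [← h1, ← h2, Finset.mul_sum, Finset.sum_mul]
  refine Finset.sum_congr rfl fun q _ => ?_
  linear_combination X q * h p q

lemma pow_rel {n : ℕ} {H P : MvPolynomial (Fin n) ℂ} {d e : ℕ} (hH : H.IsHomogeneous d)
    (hP : P.IsHomogeneous e) (h : PoissonCommute H P) (hd : d ≠ 0) (he : e ≠ 0) (hH0 : H ≠ 0) :
    ∃ c : ℂ, P ^ d = C c * H ^ e := by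
  apply uniq_sol _ _ (pow_ne_zero _ hH0)
  intro i
  have := euler_rel hH hP h i
  obtain ⟨d, rfl⟩ := Nat.exists_eq_succ_of_ne_zero hd
  obtain ⟨e, rfl⟩ := Nat.exists_eq_succ_of_ne_zero he
  rw [pderiv_pow, pderiv_pow]
  simp only [Nat.succ_eq_add_one, Nat.add_sub_cancel] at *
  rw [pow_succ, pow_succ]
  linear_combination -(H ^ e * P ^ d) * this

lemma hom_of_pow {n : ℕ} {H r : MvPolynomial (Fin n) ℂ} {d k m : ℕ} (hH : H.IsHomogeneous d)
    (hk : k ≠ 0) (hd : d = k * m) (hr : r ^ k = H) (hH0 : H ≠ 0) : r.IsHomogeneous m := by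
  have hr0 : r ≠ 0 := by rintro rfl; rw [zero_pow hk] at hr; exact hH0 hr.symm
  have h1 := hH.sum_X_mul_pderiv
  rw [nsmul_eq_mul, ← hr] at h1
  obtain ⟨k, rfl⟩ := Nat.exists_eq_succ_of_ne_zero hk
  have h2 : ∑ i, X i * pderiv i r = (m : MvPolynomial (Fin n) ℂ) * r := by
    have hk' : ((k.succ : ℕ) : MvPolynomial (Fin n) ℂ) * r ^ k ≠ 0 :=
      mul_ne_zero (by exact_mod_cast hk) (pow_ne_zero _ hr0)
    apply mul_left_cancel₀ hk'
    rw [Finset.mul_sum]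
    rw [hd] at h1
    push_cast at h1 ⊢
    have h3 : ((k : MvPolynomial (Fin n) ℂ) + 1) * r ^ k * (m * r) = (k + 1) * m * r ^ (k+1) := by ring
    rw [h3, ← h1]
    refine Finset.sum_congr rfl fun q _ => ?_
    rw [pderiv_pow]
    push_cast [Nat.succ_eq_add_one, Nat.add_sub_cancel]
    ring
  intro s hs
  have h3 := congrArg (coeff s) h2
  rw [coeff_sum] at h3
  simp_rw [coeff_theta] at h3
  rw [← Finset.sum_mul, show (m : MvPolynomial (Fin n) ℂ) = C (m : ℂ) by simp, coeff_C_mul] at h3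
  have h4 := mul_right_cancel₀ hs h3
  rw [Finsupp.weight_apply, Finsupp.sum_fintype _ _ (by simp)]
  simp only [Pi.one_apply, smul_eq_mul, mul_one]
  exact_mod_cast h4

lemma assoc_of_pow {n : ℕ} {A B : MvPolynomial (Fin n) ℂ} {k : ℕ} {c : ℂ} (hk : k ≠ 0)
    (hc : c ≠ 0) (h : A ^ k = C c * B ^ k) : ∃ b : ℂ, b ≠ 0 ∧ A = C b * B := by
  have hu : IsUnit (C c : MvPolynomial (Fin n) ℂ) := (isUnit_iff_ne_zero.mpr hc).map C
  have h1 : Associated (A ^ k) (B ^ k) := by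
    rw [h]; exact associated_unit_mul_left _ _ hu
  have h2 : Associated B A := by
    apply associated_of_dvd_dvd
    · rw [← UniqueFactorizationMonoid.pow_dvd_pow_iff_dvd hk]; exact h1.symm.dvd
    · rw [← UniqueFactorizationMonoid.pow_dvd_pow_iff_dvd hk]; exact h1.dvd
  obtain ⟨u, hu⟩ := h2
  obtain ⟨b, hb, hb'⟩ := isUnit_iff_eq_C_of_isReduced.mp u.isUnit
  refine ⟨b, hb.ne_zero, ?_⟩
  rw [← hu, hb', mul_comm]

lemma bezout_nat (d e : ℕ) (hd : 0 < d) (he : 0 < e) :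
    ∃ u v : ℕ, u * e = d.gcd e + v * d := by
  have h := Nat.gcd_eq_gcd_ab d e
  set x := Nat.gcdA d e
  set y := Nat.gcdB d e
  -- shift by a large multiple
  set t : ℤ := |x| + |y|
  have ht : 0 ≤ t := by positivity
  have hd' : (1:ℤ) ≤ d := by exact_mod_cast hd
  have he' : (1:ℤ) ≤ e := by exact_mod_cast he
  have hu : 0 ≤ y + t * d := by
    have := neg_abs_le y; have := abs_nonneg x; nlinarith
  have hv : 0 ≤ t * e - x := by
    have := le_abs_self x; have := abs_nonneg y; nlinarith
  refine ⟨(y + t * d).toNat, (t * e - x).toNat, ?_⟩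
  zify
  rw [Int.toNat_of_nonneg hu, Int.toNat_of_nonneg hv, h]
  ring

set_option maxHeartbeats 2000000 in
lemma hom_case {n : ℕ} {H P : MvPolynomial (Fin n) ℂ} {d e : ℕ} (hH : H.IsHomogeneous d)
    (hd : d ≠ 0) (hH0 : H ≠ 0) (hnp : NotProperPower H)
    (hP : P.IsHomogeneous e) (h : PoissonCommute H P) :
    ∃ (c : ℂ) (k : ℕ), P = C c * H ^ k := by
  by_cases hP0 : P = 0
  · exact ⟨0, 0, by simp [hP0]⟩
  by_cases he : e = 0
  · subst he
    refine ⟨coeff 0 P, 0, ?_⟩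
    rw [pow_zero, mul_one]
    exact totalDegree_eq_zero_iff_eq_C.mp (Nat.le_zero.mp hP.totalDegree_le)
  obtain ⟨c, hc⟩ := pow_rel hH hP h hd he hH0
  have hc0 : c ≠ 0 := by
    rintro rfl
    rw [map_zero, zero_mul] at hc
    exact hP0 (pow_eq_zero_iff hd |>.mp hc)
  obtain ⟨u, v, huv⟩ := bezout_nat d e (Nat.pos_of_ne_zero hd) (Nat.pos_of_ne_zero he)
  have hg0 : d.gcd e ≠ 0 := Nat.gcd_ne_zero_left hd
  obtain ⟨d', hd'⟩ := Nat.gcd_dvd_left d e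
  obtain ⟨e', he'⟩ := Nat.gcd_dvd_right d e
  generalize d.gcd e = g at huv hg0 hd' he'
  have key : (P ^ u) ^ d = C (c ^ u) * (H ^ g * (H ^ v) ^ d) := by
    rw [← pow_mul, mul_comm u d, pow_mul, hc, mul_pow, ← pow_mul, mul_comm e u, huv, map_pow]
    ring
  have hdvd : H ^ v ∣ P ^ u := by
    rw [← UniqueFactorizationMonoid.pow_dvd_pow_iff_dvd hd, key]
    exact Dvd.intro_left (C (c ^ u) * H ^ g) (by ring)
  obtain ⟨r, hr⟩ := hdvd
  have hrd : r ^ d = C (c ^ u) * H ^ g := by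
    apply mul_left_cancel₀ (pow_ne_zero d (pow_ne_zero v hH0))
    rw [← mul_pow, ← hr, key]; ring
  have hrd' : (r ^ d') ^ g = C (c ^ u) * H ^ g := by
    rw [← pow_mul, mul_comm, ← hd', hrd]
  obtain ⟨b, hb, hbr⟩ := assoc_of_pow hg0 (pow_ne_zero u hc0) hrd'
  have hd'0 : d' ≠ 0 := by rintro rfl; exact hd (by simpa using hd')
  have hd1 : d' = 1 := by
    by_contra hne
    apply hnp
    refine ⟨b⁻¹, r, d', g, by omega, ?_, ?_, ?_⟩
    · refine hom_of_pow (H := C b * H) (d := d) (k := d') (hH.C_mul b) hd'0 (by rw [mul_comm]; exact hd') hbr ?_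
      exact mul_ne_zero (by simpa using hb) hH0
    · rw [hH.totalDegree hH0]
      have : 2 ≤ d' := by omega
      have : 0 < g := Nat.pos_of_ne_zero hg0
      nlinarith
    · rw [hbr, smul_eq_C_mul, ← mul_assoc, ← C_mul, inv_mul_cancel₀ hb, C_1, one_mul]
  rw [hd1, mul_one] at hd'
  rw [he', ← hd', mul_comm d e', pow_mul] at hc
  obtain ⟨b2, -, hb2⟩ := assoc_of_pow hd hc0 hc
  exact ⟨b2, e', hb2⟩

theorem stmt_1 {n : ℕ} (H P : MvPolynomial (Fin n) ℂ) (dH : ℕ)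
    (hHhom : H.IsHomogeneous dH) (hHnc : H.totalDegree ≠ 0)
    (hHnp : NotProperPower H)
    (hbr : PoissonCommute H P) :
    ∃ Q : Polynomial ℂ, P = Polynomial.aeval H Q := by
  have hH0 : H ≠ 0 := by rintro rfl; simp at hHnc
  have hd : dH ≠ 0 := by rw [← hHhom.totalDegree hH0]; exact hHnc
  have key : ∀ j, ∃ (c : ℂ) (k : ℕ), homogeneousComponent j P = C c * H ^ k := fun j =>
    hom_case hHhom hd hH0 hHnp (homogeneousComponent_isHomogeneous j P) (comm_component hHhom hbr j)
  choose c k hck using key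
  refine ⟨∑ j ∈ Finset.range (P.totalDegree + 1), Polynomial.C (c j) * Polynomial.X ^ (k j), ?_⟩
  conv_lhs => rw [← sum_homogeneousComponent P]
  rw [map_sum]
  refine Finset.sum_congr rfl fun j _ => ?_
  rw [hck j]
  simp [MvPolynomial.algebraMap_eq]
end

section
/- Assume the setup with deg h = 1, and suppose deg[F,G] < d + i for some i ∈ {1,…,N}. Then there exist constants a_i, a_{i+1}, …, a_{N−1} ∈ ℂ such that for every j with i ≤ j ≤ N, the identity G_j = Σ_{α ∈ Z_{j,N,d}} c^{(j)}_α·F₁^{α₁}⋯F_s^{α_s}·h^{α₀} holds in the localization ℂ[x₁,…,xₙ][1/h], where c^{(j)}_α = (∏_{k=1}^{α₁+⋯+α_s}(α₀+d·k)) / ((∏_{i₁=1}^{α₁} d·i₁)·(∏_{i₂=1}^{α₂} d·i₂)⋯(∏_{i_s=1}^{α_s} d·i_s)) · a_{α₀+d(α₁+⋯+α_s)}, with a_N the constant from the setup. -/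
open MvPolynomial

noncomputable section

/-- `deg [f,g] < B`, where `deg [f,g] = 2 + max` of the total degrees of the Jacobian
minors (with the convention `deg 0 = -∞`). -/
def PoissonDegLT {n : ℕ} (f g : MvPolynomial (Fin n) ℂ) (B : ℤ) : Prop :=
  ∀ p q : Fin n,
    pderiv p f * pderiv q g - pderiv q f * pderiv p g = 0 ∨
    ((pderiv p f * pderiv q g - pderiv q f * pderiv p g).totalDegree : ℤ) + 2 < B

/-- The set `Z_{j,N,d}` of multi-indices `(α₀,α₁,…,α_s) ∈ ℤ × ℕ^s` (here `s = d-1`,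
and `α.2 l` represents `α_{l+1}`) with `α₀ + α₁ + 2α₂ + ⋯ + sα_s = j` and
`α₀ + d(α₁ + ⋯ + α_s) ≤ N`. -/
def Zset (s : ℕ) (j N d : ℤ) : Set (ℤ × (Fin s → ℕ)) :=
  {α | α.1 + ∑ l : Fin s, ((l : ℤ) + 1) * (α.2 l : ℤ) = j ∧
       α.1 + d * ∑ l : Fin s, (α.2 l : ℤ) ≤ N}

/-- The image of `h` in the localization `ℂ[x₁,…,xₙ][1/h]`, as a unit. -/
def hUnit {n : ℕ} (h : MvPolynomial (Fin n) ℂ) : (Localization.Away h)ˣ :=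
  (IsLocalization.Away.algebraMap_isUnit (S := Localization.Away h) h).unit

/-- The monomial `F₁^{α₁} ⋯ F_s^{α_s} · h^{α₀}` (with `α₀ ∈ ℤ`) in `ℂ[x₁,…,xₙ][1/h]`,
where `Fl l` is the homogeneous component of `F` of degree `l+1`. -/
def monom {n : ℕ} (h : MvPolynomial (Fin n) ℂ) (s : ℕ)
    (Fl : Fin s → MvPolynomial (Fin n) ℂ) (α : ℤ × (Fin s → ℕ)) :
    Localization.Away h :=
  (∏ l : Fin s, algebraMap (MvPolynomial (Fin n) ℂ) (Localization.Away h) (Fl l) ^ α.2 l) *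
    ((hUnit h ^ α.1 : (Localization.Away h)ˣ) : Localization.Away h)


theorem exists_lift_derivation {A L : Type*} [CommRing A] [CommRing L] [Algebra ℂ A] [Algebra ℂ L]
    [Algebra A L] [IsScalarTower ℂ A L] (h : A) [IsLocalization.Away h L]
    (D : Derivation ℂ A A) :
    ∃ D' : Derivation ℂ L L, ∀ a, D' (algebraMap A L a) = algebraMap A L (D a) := by
  let f : A →+* TrivSqZeroExt L L :=
    { toFun := fun a => TrivSqZeroExt.inl (algebraMap A L a) + TrivSqZeroExt.inr (algebraMap A L (D a))
      map_one' := by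
        ext <;> simp
      map_zero' := by
        ext <;> simp
      map_add' := fun a b => by
        ext <;> simp [Algebra.smul_def]
      map_mul' := fun a b => by
        ext
        · simp
        · simp only [TrivSqZeroExt.snd_mul, TrivSqZeroExt.snd_add, TrivSqZeroExt.fst_add,
            TrivSqZeroExt.snd_inl, TrivSqZeroExt.snd_inr, TrivSqZeroExt.fst_inl,
            TrivSqZeroExt.fst_inr, Derivation.leibniz, map_add, map_mul, smul_eq_mul,
            op_smul_eq_smul, add_zero, zero_add] }
  have hf : ∀ a, f a = TrivSqZeroExt.inl (algebraMap A L a) + TrivSqZeroExt.inr (algebraMap A L (D a)) :=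
    fun _ => rfl
  have hu : IsUnit (f h) := by
    rw [TrivSqZeroExt.isUnit_iff_isUnit_fst]
    simpa [hf] using IsLocalization.Away.algebraMap_isUnit (S := L) h
  let g : L →+* TrivSqZeroExt L L := IsLocalization.Away.lift h hu
  have hg : ∀ a, g (algebraMap A L a) = f a := fun a => IsLocalization.Away.lift_eq h hu a
  have hfst : ∀ x, (g x).fst = x := by
    have : ((TrivSqZeroExt.fstHom L L L : TrivSqZeroExt L L →ₐ[L] L) : TrivSqZeroExt L L →+* L).comp g = RingHom.id L := by
      apply IsLocalization.ringHom_ext (Submonoid.powers h)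
      ext a
      simp [hg, hf]
    intro x
    exact congrArg (fun φ => φ x) this
  have hsm : ∀ (c : ℂ) x, (g (c • x)).snd = c • (g x).snd := by
    intro c x
    have : c • x = algebraMap A L (algebraMap ℂ A c) * x := by
      rw [Algebra.smul_def, ← IsScalarTower.algebraMap_apply]
    rw [this, map_mul, TrivSqZeroExt.snd_mul, hg, hfst, hf]
    have h3 : D (algebraMap ℂ A c) = 0 := D.map_algebraMap c
    simp [h3, Algebra.smul_def, ← IsScalarTower.algebraMap_apply]
  refine ⟨Derivation.mk' { toFun := fun x => (g x).snd, map_add' := ?_, map_smul' := ?_ } ?_, ?_⟩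
  · intro x y; simp
  · intro c x; simpa using hsm c x
  · intro x y
    change (g (x * y)).snd = x * (g y).snd + y * (g x).snd
    rw [map_mul, TrivSqZeroExt.snd_mul, hfst, hfst, smul_eq_mul, op_smul_eq_smul, smul_eq_mul]
  · intro a
    change (g (algebraMap A L a)).snd = _
    rw [hg, hf, TrivSqZeroExt.snd_add, TrivSqZeroExt.snd_inl, TrivSqZeroExt.snd_inr, zero_add]

theorem exists_coeff_derivation {L : Type*} [CommRing L] [Algebra ℂ L] (D : Derivation ℂ L L) :
    ∃ D' : Derivation ℂ (Polynomial L) (Polynomial L),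
      ∀ p n, (D' p).coeff n = D (p.coeff n) := by
  refine ⟨(PolynomialModule.equivPolynomialSelf (R := L)).toLinearMap.compDer D.mapCoeffs, ?_⟩
  intro p n
  rfl

theorem const_of_pderiv_zero {n : ℕ} (P : MvPolynomial (Fin n) ℂ) (hP : ∀ p, pderiv p P = 0) :
    ∃ c : ℂ, P = C c := by
  refine ⟨coeff 0 P, ?_⟩
  ext m
  rw [coeff_C]
  split_ifs with hm
  · rw [hm]
  · obtain ⟨p, hp⟩ : ∃ p, m p ≠ 0 := by
      by_contra hcon
      push Not at hcon
      exact hm (by ext p; simp [hcon p])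
    have h1 := congrArg (coeff (m - Finsupp.single p 1)) (hP p)
    rw [coeff_pderiv] at h1
    have h2 : m - Finsupp.single p 1 + Finsupp.single p 1 = m := by
      apply tsub_add_cancel_of_le
      simp only [Finsupp.single_le_iff]; omega
    rw [h2, coeff_zero] at h1
    rcases mul_eq_zero.1 h1 with h3 | h3
    · exact h3
    · exfalso; revert h3; norm_cast

theorem poly_const {n : ℕ} (h : MvPolynomial (Fin n) ℂ) (hh : h.IsHomogeneous 1) (h0 : h ≠ 0)
    (k : ℕ) : ∀ P : MvPolynomial (Fin n) ℂ,
      (∀ p, pderiv p P * h = (k : MvPolynomial (Fin n) ℂ) * P * pderiv p h) →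
      ∃ c : ℂ, P = C c * h ^ k := by
  induction k with
  | zero =>
    intro P hP
    obtain ⟨c, hc⟩ := const_of_pderiv_zero P (fun p => by
      have := hP p
      simpa [h0] using this)
    exact ⟨c, by simp [hc]⟩
  | succ k ih =>
    intro P hP
    obtain ⟨p, hp⟩ : ∃ p, pderiv p h ≠ 0 := by
      by_contra hcon
      push Not at hcon
      have := hh.sum_X_mul_pderiv
      simp [hcon] at this
      exact h0 this.symm
    obtain ⟨c, hc⟩ : ∃ c : ℂ, pderiv p h = C c := by
      have := hh.pderiv (i := p)
      exact ⟨_, (totalDegree_eq_zero_iff_eq_C (p := pderiv p h)).1 (by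
        have := this.totalDegree_le; omega)⟩
    have hc0 : c ≠ 0 := by rintro rfl; simp [hc] at hp
    have hk : ((k : ℂ) + 1) ≠ 0 := by norm_cast
    have hdvd : P = h * (C (((k : ℂ) + 1)⁻¹ * c⁻¹) * pderiv p P) := by
      have h1 := hP p
      rw [hc] at h1
      have h2 : ((k+1 : ℕ) : MvPolynomial (Fin n) ℂ) = C ((k : ℂ) + 1) := by simp
      rw [h2] at h1
      calc P = C ((((k : ℂ) + 1)⁻¹ * c⁻¹) * (((k : ℂ) + 1) * c)) * P := by
            rw [show (((k : ℂ) + 1)⁻¹ * c⁻¹) * (((k : ℂ) + 1) * c) = 1 by field_simp]; simp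
        _ = C (((k : ℂ) + 1)⁻¹ * c⁻¹) * (C ((k : ℂ) + 1) * P * C c) := by
            simp only [C_mul]; ring
        _ = _ := by rw [← h1]; ring
    obtain ⟨Q, hQ⟩ : ∃ Q, P = h * Q := ⟨_, hdvd⟩
    obtain ⟨c', hc'⟩ := ih Q (fun q => by
      have h1 := hP q
      rw [hQ] at h1
      simp only [Derivation.leibniz, smul_eq_mul] at h1
      apply mul_left_cancel₀ h0
      push_cast at h1
      linear_combination h1)
    exact ⟨c', by rw [hQ, hc']; ring⟩

theorem loc_const {n : ℕ} (h : MvPolynomial (Fin n) ℂ) (hh : h.IsHomogeneous 1) (h0 : h ≠ 0)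
    (D : Fin n → Derivation ℂ (Localization.Away h) (Localization.Away h))
    (hD : ∀ p a, D p (algebraMap (MvPolynomial (Fin n) ℂ) _ a) = algebraMap (MvPolynomial (Fin n) ℂ) _ (pderiv p a))
    (m : ℕ) (R : Localization.Away h)
    (hR : ∀ p, D p R * algebraMap (MvPolynomial (Fin n) ℂ) _ h = (m : Localization.Away h) * R *
      algebraMap (MvPolynomial (Fin n) ℂ) _ (pderiv p h)) :
    ∃ c : ℂ, R = c • (algebraMap (MvPolynomial (Fin n) ℂ) _ h : Localization.Away h) ^ m := by
  have hle : Submonoid.powers h ≤ nonZeroDivisors (MvPolynomial (Fin n) ℂ) :=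
    powers_le_nonZeroDivisors_of_noZeroDivisors h0
  have hinj : Function.Injective (algebraMap (MvPolynomial (Fin n) ℂ) (Localization.Away h)) :=
    IsLocalization.injective _ hle
  have hunit := IsLocalization.Away.algebraMap_isUnit (S := Localization.Away h) h
  obtain ⟨k, P, hP⟩ := IsLocalization.Away.surj (S := Localization.Away h) h R
  obtain ⟨c, hc⟩ := poly_const h hh h0 (m + k) P (fun p => by
    apply hinj
    simp only [map_mul, ← hD, ← hP, Derivation.leibniz, Derivation.leibniz_pow, smul_eq_mul, map_natCast]
    have h1 := hR p
    rw [← hD] at h1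
    rcases k with _ | k
    · push_cast; simp only [pow_zero, zero_smul, mul_zero]; linear_combination h1
    · simp only [Nat.add_sub_cancel, nsmul_eq_mul]
      push_cast
      linear_combination (algebraMap (MvPolynomial (Fin n) ℂ) (Localization.Away h) h)^(k+1) * h1)
  refine ⟨c, ?_⟩
  apply (hunit.pow k).mul_right_cancel
  rw [hP, hc, map_mul, map_pow, pow_add, Algebra.smul_def, ← mul_assoc]
  rfl

/-- Coefficients of the binomial series `(1+w)^(m/d)`. -/
def bco (m d k : ℕ) : ℂ :=
  (∏ i ∈ Finset.range k, ((m : ℂ) - d * i)) / (d ^ k * (k.factorial : ℂ))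

theorem bco_succ (m d k : ℕ) (hd : d ≠ 0) :
    (d : ℂ) * (bco m d (k+1) * (k+1)) = (m - d * k) * bco m d k := by
  have h1 : (d : ℂ) ≠ 0 := by exact_mod_cast hd
  have h2 : (k : ℂ) + 1 ≠ 0 := by norm_cast
  have h3 : (k.factorial : ℂ) ≠ 0 := by exact_mod_cast k.factorial_ne_zero
  unfold bco
  rw [Finset.prod_range_succ, Nat.factorial_succ]
  push_cast
  field_simp
  ring

/-- Truncated binomial series. -/
def Bser {R : Type*} [CommRing R] [Algebra ℂ R] (m d M : ℕ) (w : R) : R :=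
  ∑ k ∈ Finset.range M, bco m d k • w ^ k

/-- Formal derivative of the truncated binomial series. -/
def Bder {R : Type*} [CommRing R] [Algebra ℂ R] (m d M : ℕ) (w : R) : R :=
  ∑ k ∈ Finset.range M, (bco m d k * k) • w ^ (k - 1)

theorem der_Bser {R : Type*} [CommRing R] [Algebra ℂ R] (m d M : ℕ) (w : R)
    (D : Derivation ℂ R R) : D (Bser m d M w) = Bder m d M w * D w := by
  unfold Bser Bder
  rw [map_sum, Finset.sum_mul]
  refine Finset.sum_congr rfl fun k _ => ?_
  rw [D.map_smul, D.leibniz_pow, mul_smul, smul_mul_assoc, smul_mul_assoc, smul_eq_mul]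
  congr 1
  rw [nsmul_eq_mul, Algebra.smul_def, map_natCast]

theorem Bser_ode {R : Type*} [CommRing R] [Algebra ℂ R] (m d M : ℕ) (w : R) (hd : d ≠ 0) :
    (d : R) * ((1 + w) * Bder m d (M+1) w) - m * Bser m d (M+1) w =
      ((d * M - m) * bco m d M : ℂ) • w ^ M := by
  induction M with
  | zero =>
    simp [Bder, Bser, Algebra.smul_def]
  | succ M ih =>
    have e1 : Bder m d (M+1+1) w = Bder m d (M+1) w + (bco m d (M+1) * ((M+1 : ℕ) : ℂ)) • w ^ M := by
      unfold Bder; rw [Finset.sum_range_succ _ (M+1)]; simp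
    have e2 : Bser m d (M+1+1) w = Bser m d (M+1) w + bco m d (M+1) • w ^ (M+1) := by
      unfold Bser; rw [Finset.sum_range_succ _ (M+1)]
    have hb := congrArg (algebraMap ℂ R) (bco_succ m d M hd)
    rw [e1, e2]
    simp only [Algebra.smul_def, map_mul, map_sub, map_natCast, map_add, map_one, Nat.cast_add, Nat.cast_one] at *
    linear_combination ih + w ^ M * hb

theorem bracket_V {R : Type*} [CommRing R] [Algebra ℂ R] (m d M : ℕ) (h w : R) (hd : d ≠ 0)
    (hm : m ≠ 0) (Dp Dq : Derivation ℂ R R) :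
    w ^ M ∣ Dp (h ^ d * (1 + w)) * Dq (h ^ m * Bser m d (M+1) w) -
      Dq (h ^ d * (1 + w)) * Dp (h ^ m * Bser m d (M+1) w) := by
  obtain ⟨d, rfl⟩ := Nat.exists_eq_succ_of_ne_zero hd
  obtain ⟨m, rfl⟩ := Nat.exists_eq_succ_of_ne_zero hm
  have key := Bser_ode (m+1) (d+1) M w hd
  simp only [Nat.succ_eq_add_one, Derivation.leibniz, Derivation.leibniz_pow, der_Bser, map_add,
    Derivation.map_one_eq_zero, smul_eq_mul, nsmul_eq_mul, Nat.add_sub_cancel]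
  rw [Algebra.smul_def] at key
  refine ⟨h ^ (d + m + 1) * (Dp h * Dq w - Dq h * Dp w) *
    algebraMap ℂ R (((d+1 : ℕ) * M - (m+1 : ℕ)) * bco (m+1) (d+1) M), ?_⟩
  linear_combination (h ^ (d + m + 1) * (Dp h * Dq w - Dq h * Dp w)) * key

theorem Bser_coeff_zero {L : Type*} [CommRing L] [Algebra ℂ L] (m d M : ℕ) (w : Polynomial L)
    (hw0 : w.coeff 0 = 0) : (Bser m d (M + 1) w).coeff 0 = 1 := by
  unfold Bser
  rw [Finset.sum_range_succ', Polynomial.coeff_add, Polynomial.finsetSum_coeff,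
    Finset.sum_eq_zero]
  · simp [bco]
  · intro k _
    rw [Polynomial.coeff_smul, pow_succ, Polynomial.mul_coeff_zero, hw0]; simp

theorem main_ind {n : ℕ} {L : Type*} [CommRing L] [Algebra ℂ L]
    (x : Fin n → L) (D : Fin n → Derivation ℂ L L) (h : L) (hu : IsUnit h) (d N i : ℕ)
    (hd : 2 ≤ d) (hi : 1 ≤ i) (hiN : i ≤ N)
    (w G : Polynomial L) (hw : Polynomial.X ∣ w)
    (Dh : Fin n → Derivation ℂ (Polynomial L) (Polynomial L))
    (hDh : ∀ p P r, (Dh p P).coeff r = D p (P.coeff r))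
    (Th : Derivation ℂ (Polynomial L) (Polynomial L))
    (hTh : ∀ P r, (Th P).coeff r = ∑ q, x q * D q (P.coeff r) + (r : L) * P.coeff r)
    (hEh : ∑ q, x q * D q h = h)
    (hEw : Th w = 0)
    (hEG : ∀ r, r ≤ N → (Th G).coeff r = (N : L) * G.coeff r)
    (hbr : ∀ p q r, r + i ≤ N →
      (Dh p (Polynomial.C h ^ d * (1 + w)) * Dh q G -
        Dh q (Polynomial.C h ^ d * (1 + w)) * Dh p G).coeff r = 0)
    (hconst : ∀ (m : ℕ) (R : L), (∀ p, D p R * h = (m : L) * R * D p h) →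
      ∃ c : ℂ, R = c • h ^ m) (K : ℕ) :
    K ≤ N - i + 1 → ∃ a : ℕ → ℂ, ∀ r, r < K →
      G.coeff r = (∑ k ∈ Finset.range K, a k • (Polynomial.X ^ k *
        (Polynomial.C h ^ (N - k) * Bser (N - k) d (N + 2) w))).coeff r := by
  induction K with
  | zero => intro _; exact ⟨0, fun r hr => by omega⟩
  | succ K ih =>
    intro hK
    obtain ⟨a, ha⟩ := ih (by omega)
    set W : ℕ → Polynomial L := fun k => Polynomial.X ^ k *
        (Polynomial.C h ^ (N - k) * Bser (N - k) d (N + 2) w) with hW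
    set Ft := Polynomial.C h ^ d * (1 + w) with hFt
    have hX : ∀ p, Dh p Polynomial.X = 0 := by
      intro p; ext r; rw [hDh, Polynomial.coeff_X]; split_ifs <;> simp
    have hThX : Th Polynomial.X = Polynomial.X := by
      ext r; rw [hTh, Polynomial.coeff_X]; split_ifs with hr
      · subst hr; simp
      · simp
    have hThC : Th (Polynomial.C h) = Polynomial.C h := by
      ext r; rw [hTh, Polynomial.coeff_C]; split_ifs with hr
      · subst hr; simp [hEh]
      · simp
    have hThW : ∀ k, k ≤ N → Th (W k) = (N : Polynomial L) * W k := by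
      intro k hk
      have hpow : ∀ (y : Polynomial L) (_ : Th y = y) (e : ℕ), Th (y ^ e) = (e : Polynomial L) * y ^ e := by
        intro y hy e
        rcases e with _ | e
        · simp
        · rw [Th.leibniz_pow, hy]; simp [pow_succ]
      simp only [hW, Derivation.leibniz, der_Bser, hEw, hpow _ hThX, hpow _ hThC, smul_eq_mul]
      have : (N : Polynomial L) = ((N - k : ℕ) : Polynomial L) + (k : Polynomial L) := by
        rw [← Nat.cast_add]; congr 1; omega
      rw [this]; ring
    set P := G - ∑ k ∈ Finset.range K, a k • W k with hP
    have hPK : Polynomial.X ^ K ∣ P := by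
      rw [Polynomial.X_pow_dvd_iff]
      intro r hr
      rw [hP, Polynomial.coeff_sub, ha r hr, sub_self]
    obtain ⟨Q, hQ⟩ := hPK
    set R := Q.coeff 0 with hR
    have hPR : P.coeff K = R := by
      rw [hQ, Polynomial.coeff_X_pow_mul', if_pos le_rfl, Nat.sub_self]
    -- bracket with P
    have hdw : ∀ p q k, k < K → (Dh p Ft * Dh q (W k) - Dh q Ft * Dh p (W k)).coeff K = 0 := by
      intro p q k hk
      have h1 := bracket_V (N - k) d (N+1) (Polynomial.C h) w (by omega) (by omega) (Dh p) (Dh q)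
      have h2 : Polynomial.X ^ (N+1) ∣ Dh p Ft * Dh q (W k) - Dh q Ft * Dh p (W k) := by
        have h3 : Dh p Ft * Dh q (W k) - Dh q Ft * Dh p (W k) = Polynomial.X ^ k *
          (Dh p Ft * Dh q (Polynomial.C h ^ (N - k) * Bser (N - k) d (N + 2) w) -
            Dh q Ft * Dh p (Polynomial.C h ^ (N - k) * Bser (N - k) d (N + 2) w)) := by
          simp only [hW]
          rw [(Dh p).leibniz (Polynomial.X ^ k), (Dh q).leibniz (Polynomial.X ^ k)]
          simp only [Derivation.leibniz_pow, hX, smul_zero, smul_eq_mul]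
          ring
        rw [h3]
        exact Dvd.dvd.mul_left ((pow_dvd_pow_of_dvd hw _).trans h1) _
      exact (Polynomial.X_pow_dvd_iff.1 h2) K (by omega)
    have hbrP : ∀ p q, (Dh p Ft * Dh q P - Dh q Ft * Dh p P).coeff K = 0 := by
      intro p q
      have h1 : Dh p Ft * Dh q P - Dh q Ft * Dh p P = (Dh p Ft * Dh q G - Dh q Ft * Dh p G) -
          ∑ k ∈ Finset.range K, a k • (Dh p Ft * Dh q (W k) - Dh q Ft * Dh p (W k)) := by
        simp only [hP, map_sub, map_sum, Derivation.map_smul, smul_sub, Finset.sum_sub_distrib,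
          ← mul_smul_comm, ← Finset.mul_sum]
        ring
      rw [h1, Polynomial.coeff_sub, hbr p q K (by omega), Polynomial.finsetSum_coeff,
        Finset.sum_eq_zero, sub_zero]
      intro k hk
      rw [Polynomial.coeff_smul, hdw p q k (Finset.mem_range.1 hk), smul_zero]
    have hw0 : w.coeff 0 = 0 := Polynomial.X_dvd_iff.1 hw
    have hF0 : Ft.coeff 0 = h ^ d := by
      simp [hFt, Polynomial.mul_coeff_zero, hw0, Polynomial.coeff_zero_eq_eval_zero]
      simp [← Polynomial.coeff_zero_eq_eval_zero, hw0]
    have hbrR : ∀ p q, D p h * D q R = D q h * D p R := by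
      intro p q
      have h1 := hbrP p q
      have h2 : Dh p Ft * Dh q P - Dh q Ft * Dh p P =
          Polynomial.X ^ K * (Dh p Ft * Dh q Q - Dh q Ft * Dh p Q) := by
        rw [hQ]
        simp only [Derivation.leibniz, Derivation.leibniz_pow, hX, smul_zero, smul_eq_mul]
        ring
      rw [h2, Polynomial.coeff_X_pow_mul', if_pos le_rfl, Nat.sub_self, Polynomial.coeff_sub,
        Polynomial.mul_coeff_zero, Polynomial.mul_coeff_zero] at h1
      simp only [hDh, hF0, Derivation.leibniz_pow, smul_eq_mul, nsmul_eq_mul] at h1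
      have hdu : IsUnit ((d : L) * h ^ (d-1)) := by
        refine IsUnit.mul ?_ (hu.pow _)
        have : IsUnit ((d : ℂ)) := by
          rw [isUnit_iff_ne_zero]; norm_cast; omega
        simpa using this.map (algebraMap ℂ L)
      apply hdu.mul_left_cancel
      linear_combination h1
    have hThR : ∑ q, x q * D q R = ((N - K : ℕ) : L) * R := by
      have h1 : (Th P).coeff K = (N : L) * P.coeff K := by
        simp only [hP, map_sub, map_sum, Derivation.map_smul, Polynomial.coeff_sub,
          Polynomial.finsetSum_coeff, Polynomial.coeff_smul]
        rw [hEG K (by omega), mul_sub, Finset.mul_sum]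
        congr 1
        refine Finset.sum_congr rfl fun k hk => ?_
        have := Finset.mem_range.1 hk
        rw [hThW k (by omega), Polynomial.coeff_natCast_mul, mul_smul_comm]
      rw [hTh, hPR] at h1
      have : (N : L) = ((N - K : ℕ) : L) + (K : L) := by
        rw [← Nat.cast_add]; congr 1; omega
      rw [this] at h1
      linear_combination h1
    obtain ⟨c, hc⟩ := hconst (N - K) R (fun p => by
      rw [← hThR]
      nth_rewrite 1 [← hEh]
      rw [Finset.mul_sum, Finset.sum_mul]
      refine Finset.sum_congr rfl fun q _ => ?_
      linear_combination - x q * hbrR p q)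
    refine ⟨Function.update a K c, fun r hr => ?_⟩
    rw [Finset.sum_range_succ, Function.update_self]
    have h1 : ∑ k ∈ Finset.range K, Function.update a K c k • W k =
        ∑ k ∈ Finset.range K, a k • W k := by
      refine Finset.sum_congr rfl fun k hk => ?_
      have := Finset.mem_range.1 hk
      rw [Function.update_of_ne (by omega)]
    rw [h1]
    have h2 : G = P + ∑ k ∈ Finset.range K, a k • W k := by rw [hP]; ring
    rw [h2, add_comm, Polynomial.coeff_add, Polynomial.coeff_add]
    congr 1
    rw [Polynomial.coeff_smul, hQ]
    rw [Polynomial.coeff_X_pow_mul', Polynomial.coeff_X_pow_mul']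
    split_ifs with hKr
    · have : r - K = 0 := by omega
      rw [this, ← hR, hc]
      congr 1
      have hB := Bser_coeff_zero (N - K) d (N + 1) w hw0
      rw [Polynomial.mul_coeff_zero, hB, ← Polynomial.C_pow, Polynomial.coeff_C_zero, mul_one]
    · simp

theorem exists_euler {n : ℕ} {L : Type*} [CommRing L] [Algebra ℂ L]
    (x : Fin n → L) (D : Fin n → Derivation ℂ L L) :
    ∃ Th : Derivation ℂ (Polynomial L) (Polynomial L),
      ∀ P r, (Th P).coeff r = ∑ q, x q * D q (P.coeff r) + (r : L) * P.coeff r := by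
  obtain ⟨E, hE⟩ := exists_coeff_derivation (∑ q, x q • D q)
  refine ⟨E + (Polynomial.X : Polynomial L) •
    (Polynomial.derivative' (R := L)).restrictScalars ℂ, fun P r => ?_⟩
  have h1 : (∑ q, x q • D q) (P.coeff r) = ∑ q, x q * D q (P.coeff r) := by
    generalize P.coeff r = y
    have : ∀ S : Finset (Fin n), (∑ q ∈ S, x q • D q) y = ∑ q ∈ S, x q * D q y := by
      intro S
      induction S using Finset.induction_on with
      | empty => simp
      | insert b S hb ih =>
        rw [Finset.sum_insert hb, Finset.sum_insert hb, Derivation.add_apply, ih,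
          Derivation.smul_apply, smul_eq_mul]
    exact this _
  have h2 : ((Polynomial.X : Polynomial L) * Polynomial.derivative P).coeff r = (r : L) * P.coeff r := by
    rcases r with _ | r
    · simp
    · rw [Polynomial.coeff_X_mul, Polynomial.coeff_derivative]; push_cast; ring
  rw [Derivation.add_apply, Polynomial.coeff_add, hE, h1, Derivation.smul_apply, smul_eq_mul, ← h2]
  rfl

/-- The polynomial `∑ f_{N-a} t^a`. -/
def tpol {n : ℕ} (L : Type*) [CommRing L] [Algebra (MvPolynomial (Fin n) ℂ) L]
    (f : MvPolynomial (Fin n) ℂ) (N : ℕ) : Polynomial L :=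
  ∑ a ∈ Finset.range (N + 1), Polynomial.C (algebraMap _ L (homogeneousComponent (N - a) f)) *
    Polynomial.X ^ a

theorem tpol_coeff {n : ℕ} (L : Type*) [CommRing L] [Algebra (MvPolynomial (Fin n) ℂ) L]
    (f : MvPolynomial (Fin n) ℂ) (N r : ℕ) : (tpol L f N).coeff r =
      if r ≤ N then algebraMap _ L (homogeneousComponent (N - r) f) else 0 := by
  unfold tpol
  simp only [Polynomial.finsetSum_coeff, Polynomial.coeff_C_mul, Polynomial.coeff_X_pow,
    mul_ite, mul_one, mul_zero, Finset.sum_ite_eq, Finset.mem_range, Nat.lt_succ_iff]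

theorem tpol_euler {n : ℕ} {L : Type*} [CommRing L] [Algebra ℂ L]
    [Algebra (MvPolynomial (Fin n) ℂ) L] (f : MvPolynomial (Fin n) ℂ) (N : ℕ)
    (D : Fin n → Derivation ℂ L L)
    (hD : ∀ p a, D p (algebraMap (MvPolynomial (Fin n) ℂ) L a) = algebraMap _ L (pderiv p a))
    (Th : Derivation ℂ (Polynomial L) (Polynomial L))
    (hTh : ∀ P r, (Th P).coeff r =
      ∑ q, algebraMap (MvPolynomial (Fin n) ℂ) L (X q) * D q (P.coeff r) + (r : L) * P.coeff r) :
    Th (tpol L f N) = (N : Polynomial L) * tpol L f N := by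
  ext r
  rw [hTh, Polynomial.coeff_natCast_mul, tpol_coeff]
  split_ifs with hr
  · simp only [hD, ← map_mul, ← map_sum]
    rw [(homogeneousComponent_isHomogeneous (N - r) f).sum_X_mul_pderiv]
    have : (N : L) = ((N - r : ℕ) : L) + (r : L) := by
      rw [← Nat.cast_add]; congr 1; omega
    rw [this, nsmul_eq_mul, map_mul, map_natCast]
    ring
  · simp

theorem sum_tpol {n : ℕ} (f : MvPolynomial (Fin n) ℂ) (N : ℕ) (hf : f.totalDegree = N) :
    f = ∑ a ∈ Finset.range (N + 1), homogeneousComponent (N - a) f := by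
  conv_lhs => rw [← sum_homogeneousComponent f, hf]
  rw [← Finset.sum_range_reflect]
  refine Finset.sum_congr rfl fun a _ => ?_
  congr 2

theorem hc_mul {n : ℕ} (f g : MvPolynomial (Fin n) ℂ) (d N : ℕ) (hf : f.totalDegree = d)
    (hg : g.totalDegree = N) (p q : Fin n) (r : ℕ) (hr : r + 2 ≤ d + N) :
    homogeneousComponent (d + N - r - 2) (pderiv p f * pderiv q g) =
      ∑ a ∈ Finset.range (d + 1), ∑ b ∈ Finset.range (N + 1),
        if r = a + b then pderiv p (homogeneousComponent (d - a) f) *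
          pderiv q (homogeneousComponent (N - b) g) else 0 := by
  conv_lhs => rw [sum_tpol f d hf, sum_tpol g N hg]
  rw [map_sum, map_sum, Finset.sum_mul_sum, map_sum]
  refine Finset.sum_congr rfl fun a ha => ?_
  rw [map_sum]
  refine Finset.sum_congr rfl fun b hb => ?_
  rw [Finset.mem_range] at ha hb
  by_cases had : d - a = 0
  · rw [had]; simp
  by_cases hbN : N - b = 0
  · rw [hbN]; simp
  have h1 := ((homogeneousComponent_isHomogeneous (d - a) f).pderiv (i := p)).mul
    ((homogeneousComponent_isHomogeneous (N - b) g).pderiv (i := q))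
  rw [homogeneousComponent_of_mem h1]
  congr 1
  apply propext
  omega

theorem tpol_bracket {n : ℕ} {L : Type*} [CommRing L] [Algebra ℂ L]
    [Algebra (MvPolynomial (Fin n) ℂ) L] (f g : MvPolynomial (Fin n) ℂ) (d N i : ℕ)
    (hf : f.totalDegree = d) (hg : g.totalDegree = N) (hd : 2 ≤ d)
    (hdeg : PoissonDegLT f g ((d : ℤ) + i))
    (D : Fin n → Derivation ℂ L L)
    (hD : ∀ p a, D p (algebraMap (MvPolynomial (Fin n) ℂ) L a) = algebraMap _ L (pderiv p a))
    (Dh : Fin n → Derivation ℂ (Polynomial L) (Polynomial L))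
    (hDh : ∀ p P r, (Dh p P).coeff r = D p (P.coeff r)) (p q : Fin n) (r : ℕ) (hr : r + i ≤ N) :
    (Dh p (tpol L f d) * Dh q (tpol L g N) - Dh q (tpol L f d) * Dh p (tpol L g N)).coeff r = 0 := by
  have hDt : ∀ (f : MvPolynomial (Fin n) ℂ) N p, Dh p (tpol L f N) =
      ∑ a ∈ Finset.range (N + 1),
        Polynomial.C (algebraMap _ L (pderiv p (homogeneousComponent (N - a) f))) *
        Polynomial.X ^ a := by
    intro f N p
    ext r
    rw [hDh, tpol_coeff]
    simp only [Polynomial.finsetSum_coeff, Polynomial.coeff_C_mul, Polynomial.coeff_X_pow,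
      mul_ite, mul_one, mul_zero, Finset.sum_ite_eq, Finset.mem_range, Nat.lt_succ_iff]
    split_ifs
    · rw [hD]
    · simp
  have hco : ∀ p q, (Dh p (tpol L f d) * Dh q (tpol L g N)).coeff r =
      algebraMap _ L (homogeneousComponent (d + N - r - 2) (pderiv p f * pderiv q g)) := by
    intro p q
    rw [hc_mul f g d N hf hg p q r (by omega), hDt, hDt, Finset.sum_mul_sum, map_sum,
      Polynomial.finsetSum_coeff]
    refine Finset.sum_congr rfl fun a _ => ?_
    rw [map_sum, Polynomial.finsetSum_coeff]
    refine Finset.sum_congr rfl fun b _ => ?_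
    rw [mul_mul_mul_comm, ← Polynomial.C_mul, ← pow_add, Polynomial.coeff_C_mul,
      Polynomial.coeff_X_pow]
    split_ifs <;> simp
  rw [Polynomial.coeff_sub, hco, hco, ← map_sub, ← map_sub]
  rcases hdeg p q with h0 | h0
  · rw [h0]; simp
  · rw [homogeneousComponent_eq_zero _ _ (by omega), map_zero]

theorem tpol_eq {n : ℕ} (L : Type*) [CommRing L] [Algebra (MvPolynomial (Fin n) ℂ) L]
    (f : MvPolynomial (Fin n) ℂ) (d s : ℕ) (hd : 2 ≤ d) (hs : s = d - 1) (h v : L)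
    (hv : h ^ d * v = 1)
    (hf0 : coeff 0 f = 0) (hfd : algebraMap _ L (homogeneousComponent d f) = h ^ d) :
    tpol L f d = Polynomial.C h ^ d * (1 + ∑ l : Fin s,
      Polynomial.C (algebraMap _ L (homogeneousComponent ((l : ℕ) + 1) f) * v) *
        Polynomial.X ^ (d - (l + 1))) := by
  obtain rfl : d = s + 1 := by omega
  unfold tpol
  rw [Finset.sum_range_succ, Finset.sum_range_succ', ← Finset.sum_range_reflect,
    Fin.sum_univ_eq_sum_range (fun l => Polynomial.C (algebraMap _ L (homogeneousComponent (l + 1) f) * v) *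
        Polynomial.X ^ (s + 1 - (l + 1)))]
  simp only [Nat.sub_self, homogeneousComponent_zero, hf0, map_zero, zero_mul, add_zero, Nat.sub_zero, hfd, pow_zero, mul_one]
  rw [mul_add, mul_one, add_comm, ← Polynomial.C_pow, Finset.mul_sum]
  congr 1
  refine Finset.sum_congr rfl fun a ha => ?_
  rw [Finset.mem_range] at ha
  rw [← mul_assoc, ← Polynomial.C_mul, mul_left_comm, hv, mul_one,
    show s + 1 - (s - 1 - a + 1) = a + 1 by omega, show s - 1 - a + 1 = s + 1 - (a + 1) by omega]

/-- The coefficient `c_α` (without the `a` factor). -/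
def cco (d s : ℕ) (z : ℤ) (α : Fin s → ℕ) : ℂ :=
  (∏ m ∈ Finset.Icc 1 (∑ l : Fin s, α l), ((z : ℂ) + d * m)) /
    ∏ l : Fin s, ∏ i' ∈ Finset.Icc 1 (α l), ((d : ℂ) * i')

theorem prod_Icc_mul (d a : ℕ) :
    ∏ i' ∈ Finset.Icc 1 a, ((d : ℂ) * i') = d ^ a * (a.factorial : ℂ) := by
  induction a with
  | zero => simp
  | succ a ih =>
    rw [Finset.prod_Icc_succ_top (by omega), ih, Nat.factorial_succ]
    push_cast
    ring

theorem bco_multinomial (m d s k : ℕ) (hd : d ≠ 0) (α : Fin s → ℕ) (hα : ∑ l, α l = k) :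
    bco m d k * (Nat.multinomial Finset.univ α : ℂ) = cco d s ((m : ℤ) - d * k) α := by
  have hd' : (d : ℂ) ≠ 0 := by exact_mod_cast hd
  have hspec : (∏ l, ((α l).factorial : ℂ)) * (Nat.multinomial Finset.univ α : ℂ) = k.factorial := by
    have := Nat.multinomial_spec Finset.univ α
    rw [hα] at this
    exact_mod_cast this
  have h1 : ∏ l : Fin s, ∏ i' ∈ Finset.Icc 1 (α l), ((d : ℂ) * i') =
      d ^ k * ∏ l, ((α l).factorial : ℂ) := by
    simp only [prod_Icc_mul]
    simp only [Finset.prod_mul_distrib, Finset.prod_pow_eq_pow_sum, hα]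
  have h2 : ∏ m' ∈ Finset.Icc 1 k, ((((m : ℤ) - d * k : ℤ) : ℂ) + d * m') =
      ∏ i ∈ Finset.range k, ((m : ℂ) - d * i) := by
    refine Finset.prod_nbij' (fun a => k - a) (fun a => k - a) ?_ ?_ ?_ ?_ ?_
    · intro a ha; simp at ha ⊢; omega
    · intro a ha; simp at ha ⊢; omega
    · intro a ha; simp at ha ⊢; omega
    · intro a ha; simp at ha ⊢; omega
    · intro a ha
      simp at ha
      rw [Nat.cast_sub ha.2]; push_cast; ring
  have hne : (∏ l, ((α l).factorial : ℂ)) ≠ 0 :=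
    Finset.prod_ne_zero_iff.2 fun l _ => by exact_mod_cast (α l).factorial_ne_zero
  have hk : (k.factorial : ℂ) ≠ 0 := by exact_mod_cast k.factorial_ne_zero
  unfold cco bco
  rw [hα, h1, h2, div_mul_eq_mul_div, div_eq_div_iff (by positivity) (by positivity), ← hspec]
  ring

/-- All multi-indices of total size `< M`. -/
def box (s M : ℕ) : Finset (Fin s → ℕ) :=
  (Finset.range M).biUnion fun k => Finset.piAntidiag Finset.univ k

theorem mem_box (s M : ℕ) (α : Fin s → ℕ) : α ∈ box s M ↔ ∑ l, α l < M := by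
  simp [box]

/-- Weight of a multi-index. -/
def wt (d s : ℕ) (α : Fin s → ℕ) : ℕ := ∑ l : Fin s, (d - ((l : ℕ) + 1)) * α l

theorem V_expand {L : Type*} [CommRing L] [Algebra ℂ L] (u : Lˣ) (d s m M : ℕ) (hd : d ≠ 0)
    (f : Fin s → L) :
    Polynomial.C (u : L) ^ m * Bser m d M (∑ l : Fin s,
      Polynomial.C (f l * ((u ^ (-(d : ℤ)) : Lˣ) : L)) * Polynomial.X ^ (d - ((l : ℕ) + 1))) =
    ∑ α ∈ box s M, Polynomial.C (cco d s ((m : ℤ) - d * (∑ l, α l : ℕ)) α •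
      ((∏ l, f l ^ α l) * ((u ^ ((m : ℤ) - d * (∑ l, α l : ℕ)) : Lˣ) : L))) *
        Polynomial.X ^ (wt d s α) := by
  unfold box Bser
  rw [Finset.sum_biUnion (by
    intro a _ b _ hab
    rw [Function.onFun, Finset.disjoint_left]
    intro α h1 h2
    simp only [Finset.mem_piAntidiag] at h1 h2
    exact hab (h1.1.symm.trans h2.1)), Finset.mul_sum]
  refine Finset.sum_congr rfl fun k _ => ?_
  rw [Finset.sum_pow_eq_sum_piAntidiag, Finset.smul_sum, Finset.mul_sum]
  refine Finset.sum_congr rfl fun α hα => ?_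
  have hα' : ∑ l, α l = k := by simpa using hα
  rw [hα', ← bco_multinomial m d s k hd α hα']
  have h1 : ∏ l : Fin s, (Polynomial.C (f l * ((u ^ (-(d : ℤ)) : Lˣ) : L)) *
      Polynomial.X ^ (d - ((l : ℕ) + 1))) ^ α l =
      Polynomial.C ((∏ l, f l ^ α l) * ((u ^ (-(d : ℤ) * k) : Lˣ) : L)) *
        Polynomial.X ^ (wt d s α) := by
    simp only [mul_pow, Finset.prod_mul_distrib, ← pow_mul, Finset.prod_pow_eq_pow_sum, wt,
      ← Polynomial.C_pow, map_mul, map_prod, hα']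
    rw [zpow_mul]
    simp only [zpow_natCast, Units.val_pow_eq_pow_val, map_pow]
    rw [Finset.prod_pow_eq_pow_sum, hα']
  rw [h1, Algebra.smul_def, Algebra.smul_def, Polynomial.algebraMap_apply, sub_eq_add_neg, zpow_add,
    ← neg_mul]
  simp only [map_mul, map_natCast, Units.val_mul, zpow_natCast, Units.val_pow_eq_pow_val, map_pow]
  ring
theorem stmt_5 {n : ℕ} (F G h : MvPolynomial (Fin n) ℂ) (d N s : ℕ) (aN : ℂ)
    (hd : 2 ≤ d) (hdN : d ≤ N) (hs : s = d - 1)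
    (hFdeg : F.totalDegree = d) (hGdeg : G.totalDegree = N)
    (hF0 : MvPolynomial.coeff 0 F = 0) (hG0 : MvPolynomial.coeff 0 G = 0)
    (hh : h.IsHomogeneous 1)
    (hFd : homogeneousComponent d F = h ^ d)
    (haN : aN ≠ 0) (hGN : homogeneousComponent N G = aN • h ^ N)
    (i : ℕ) (hi : 1 ≤ i) (hiN : i ≤ N)
    (hdeg : PoissonDegLT F G ((d : ℤ) + i)) :
    ∃ a : ℤ → ℂ, a N = aN ∧
      ∀ j : ℕ, i ≤ j → j ≤ N →
        algebraMap (MvPolynomial (Fin n) ℂ) (Localization.Away h)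
            (homogeneousComponent j G) =
          ∑ᶠ α ∈ Zset s j N d,
            (((∏ m ∈ Finset.Icc 1 (∑ l : Fin s, α.2 l), ((α.1 : ℂ) + d * m)) /
                ∏ l : Fin s, ∏ i' ∈ Finset.Icc 1 (α.2 l), ((d : ℂ) * i')) *
              a (α.1 + d * ∑ l : Fin s, (α.2 l : ℤ))) •
            monom h s (fun l => homogeneousComponent ((l : ℕ) + 1) F) α := by
  have hG0' : G ≠ 0 := by
    rintro rfl
    simp at hGdeg; omega
  have hh0 : h ≠ 0 := by
    rintro rfl
    have h1 : homogeneousComponent N G = 0 := by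
      rw [hGN, zero_pow (by omega), smul_zero]
    obtain ⟨m, hm, hmN⟩ := Finset.exists_mem_eq_sup G.support (support_nonempty.2 hG0')
      (fun m => m.sum fun _ e => e)
    have h3 := congrArg (coeff m) h1
    rw [coeff_homogeneousComponent, coeff_zero, if_pos] at h3
    · exact (mem_support_iff.1 hm) h3
    · rw [← hGdeg]; exact hmN.symm
  set L := Localization.Away h with hLdef
  let ι := algebraMap (MvPolynomial (Fin n) ℂ) L
  have hu : IsUnit (ι h) := IsLocalization.Away.algebraMap_isUnit (S := L) h
  have huu : ((hUnit h : Lˣ) : L) = ι h := rfl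
  have hinj : Function.Injective ι :=
    IsLocalization.injective _ (powers_le_nonZeroDivisors_of_noZeroDivisors hh0)
  choose D hD using fun p : Fin n => exists_lift_derivation (L := L) h (pderiv (R := ℂ) p)
  choose Dh hDh using fun p : Fin n => exists_coeff_derivation (D p)
  obtain ⟨Th, hTh⟩ := exists_euler (fun q => ι (X q)) D
  set f : Fin s → L := fun l => ι (homogeneousComponent ((l : ℕ) + 1) F) with hf
  set w : Polynomial L := ∑ l : Fin s,
      Polynomial.C (f l * (((hUnit h) ^ (-(d : ℤ)) : Lˣ) : L)) * Polynomial.X ^ (d - ((l : ℕ) + 1)) with hw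
  have hwX : Polynomial.X ∣ w := by
    refine Finset.dvd_sum fun l _ => Dvd.dvd.mul_left (dvd_pow_self _ ?_) _
    have := l.2; omega
  have hw0 : w.coeff 0 = 0 := Polynomial.X_dvd_iff.1 hwX
  have hFt : tpol L F d = Polynomial.C (ι h) ^ d * (1 + w) := by
    refine tpol_eq L F d s hd hs (ι h) _ ?_ hF0 ?_
    · rw [← huu, ← Units.val_pow_eq_pow_val, ← Units.val_mul, ← zpow_natCast, ← zpow_add]; simp
    · rw [hFd, map_pow]
  have hEh : ∑ q, ι (X q) * D q (ι h) = ι h := by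
    have := congrArg ι hh.sum_X_mul_pderiv
    rw [map_sum, one_smul] at this
    refine Eq.trans (Finset.sum_congr rfl fun q _ => ?_) this
    rw [hD, map_mul]
  have hEw : Th w = 0 := by
    have h1 := tpol_euler F d D hD Th hTh
    have hThC : Th (Polynomial.C (ι h)) = Polynomial.C (ι h) := by
      ext r; rw [hTh, Polynomial.coeff_C]; split_ifs with hr
      · subst hr; simp [hEh]
      · simp
    rw [hFt, Th.leibniz, Th.leibniz_pow, hThC, map_add, Th.map_one_eq_zero] at h1
    obtain ⟨e, rfl⟩ : ∃ e, d = e + 1 := ⟨d - 1, by omega⟩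
    simp only [smul_eq_mul, nsmul_eq_mul, Nat.add_sub_cancel] at h1
    apply ((hu.map Polynomial.C).pow (e + 1)).mul_left_cancel
    linear_combination h1
  obtain ⟨a, ha⟩ := main_ind (fun q => ι (X q)) D (ι h) hu d N i hd hi hiN w (tpol L G N) hwX Dh hDh
    Th hTh hEh hEw
    (fun r _ => by rw [tpol_euler G N D hD Th hTh, Polynomial.coeff_natCast_mul])
    (fun p q r hr => by
      rw [← hFt]
      exact tpol_bracket F G d N i hFdeg hGdeg hd hdeg D hD Dh hDh p q r hr)
    (fun m R hR => loc_const h hh hh0 D hD m R (fun p => by rw [hR p, hD]))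
    (N - i + 1) le_rfl
  refine ⟨fun z => a (N - z).toNat, ?_, ?_⟩
  · have h1 := ha 0 (by omega)
    rw [tpol_coeff, if_pos (Nat.zero_le _), Nat.sub_zero, hGN, Finset.sum_range_succ',
      Polynomial.coeff_add, Polynomial.finsetSum_coeff, Finset.sum_eq_zero, zero_add,
      Polynomial.coeff_smul, pow_zero, one_mul, Polynomial.mul_coeff_zero, Nat.sub_zero,
      Bser_coeff_zero _ _ _ _ hw0, ← Polynomial.C_pow, Polynomial.coeff_C_zero, mul_one] at h1
    · have h2 : ι ((aN - a 0) • h ^ N) = 0 := by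
        have h3 : ∀ (c : ℂ) (y : MvPolynomial (Fin n) ℂ), ι (c • y) = c • ι y := by
          intro c y
          rw [Algebra.smul_def, map_mul, Algebra.smul_def]; rfl
        rw [h3] at h1 ⊢
        rw [map_pow] at h1 ⊢
        rw [sub_smul, ← h1, sub_self]
      have h3 := hinj (h2.trans (map_zero ι).symm)
      rcases smul_eq_zero.1 h3 with h4 | h4
      · simp [sub_eq_zero.1 h4]
      · exact absurd h4 (pow_ne_zero _ hh0)
    · intro k _
      rw [Polynomial.coeff_smul, pow_succ, mul_assoc, mul_left_comm, Polynomial.mul_coeff_zero]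
      simp
  · intro j hij hjN
    have h1 := ha (N - j) (by omega)
    rw [tpol_coeff, if_pos (by omega), show N - (N - j) = j by omega] at h1
    change ι _ = _
    rw [h1]
    have hexp : ∀ k, Polynomial.C (ι h) ^ (N - k) * Bser (N - k) d (N + 2) w = _ :=
      fun k => V_expand (hUnit h) d s (N - k) (N + 2) (by omega) f
    simp only [hexp]
    set Y : ℕ → (Fin s → ℕ) → L := fun m α => cco d s ((m : ℤ) - d * (∑ l, α l : ℕ)) α •
      ((∏ l, f l ^ α l) * (((hUnit h) ^ ((m : ℤ) - d * (∑ l, α l : ℕ)) : Lˣ) : L)) with hY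
    have h2 : (∑ k ∈ Finset.range (N - i + 1), a k • (Polynomial.X ^ k *
        ∑ α ∈ box s (N + 2), Polynomial.C (Y (N - k) α) * Polynomial.X ^ (wt d s α))).coeff (N - j)
        = ∑ α ∈ box s (N + 2) with wt d s α ≤ N - j,
          a (N - j - wt d s α) • Y (j + wt d s α) α := by
      rw [Polynomial.finsetSum_coeff]
      simp only [Polynomial.coeff_smul, Finset.mul_sum, Polynomial.finsetSum_coeff, Finset.smul_sum]
      rw [Finset.sum_comm, Finset.sum_filter]
      refine Finset.sum_congr rfl fun α _ => ?_
      have h3 : ∀ k, (Polynomial.X ^ k * (Polynomial.C (Y (N - k) α) * Polynomial.X ^ (wt d s α))).coeff (N - j)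
          = if N - j = k + wt d s α then Y (N - k) α else 0 := by
        intro k
        rw [mul_left_comm, ← pow_add, Polynomial.coeff_C_mul, Polynomial.coeff_X_pow]
        split_ifs <;> simp
      simp only [h3]
      split_ifs with hle
      · rw [Finset.sum_eq_single (N - j - wt d s α)]
        · rw [if_pos (by omega), show N - (N - j - wt d s α) = j + wt d s α by omega]
        · intro b _ hb
          rw [if_neg (by omega), smul_zero]
        · intro hb
          exfalso; apply hb; rw [Finset.mem_range]; omega
      · refine Finset.sum_eq_zero fun k _ => ?_
        rw [if_neg (by omega), smul_zero]
    refine h2.trans ?_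
    have hwt : ∀ α : Fin s → ℕ, (wt d s α : ℤ) + ∑ l : Fin s, ((l : ℤ) + 1) * (α l : ℤ) =
        d * ∑ l : Fin s, (α l : ℤ) := by
      intro α
      unfold wt
      push_cast
      rw [← Finset.sum_add_distrib, Finset.mul_sum]
      refine Finset.sum_congr rfl fun l _ => ?_
      have := l.2
      rw [Nat.cast_sub (by omega)]
      push_cast; ring
    have hwt2 : ∀ α : Fin s → ℕ, ∑ l, α l ≤ wt d s α := by
      intro α
      refine Finset.sum_le_sum fun l _ => ?_
      have := l.2
      exact Nat.le_mul_of_pos_left _ (by omega)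
    let φ : (Fin s → ℕ) → ℤ × (Fin s → ℕ) := fun α => ((j : ℤ) - ∑ l : Fin s, ((l : ℤ) + 1) * (α l : ℤ), α)
    have hZ : Zset s j N d = ↑(((box s (N+2)).filter fun α => wt d s α ≤ N - j).image φ) := by
      ext ⟨z, α⟩
      have e1 := hwt α
      have e2 := hwt2 α
      simp only [Zset, Set.mem_setOf_eq, Finset.coe_image, Set.mem_image, Finset.mem_coe,
        Finset.mem_filter, mem_box, φ, Prod.mk.injEq]
      constructor
      · rintro ⟨hz1, hz2⟩
        exact ⟨α, ⟨by omega, by omega⟩, by omega, rfl⟩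
      · rintro ⟨β, ⟨hb1, hb2⟩, hb3, rfl⟩
        constructor <;> omega
    rw [hZ, finsum_mem_coe_finset, Finset.sum_image (by
      intro α _ β _ hab
      exact congrArg Prod.snd hab)]
    refine Finset.sum_congr rfl fun α hα => ?_
    rw [Finset.mem_filter] at hα
    have e1 := hwt α
    have e3 : ((j + wt d s α : ℕ) : ℤ) - d * (∑ l, α l : ℕ) =
        (j : ℤ) - ∑ l : Fin s, ((l : ℤ) + 1) * (α l : ℤ) := by
      push_cast; linarith
    have e4 : ((N : ℤ) - ((j : ℤ) - ∑ l : Fin s, ((l : ℤ) + 1) * (α l : ℤ) +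
        d * ∑ l : Fin s, (α l : ℤ))).toNat = N - j - wt d s α := by
      omega
    simp only [hY, φ, e3, e4, cco, monom, hf]
    rw [smul_smul, mul_comm]
end
end

section
/- Assume the setup with deg h = 1. If N is not congruent to 0 modulo d and deg[F,G] < d + i for some positive integer i with i < ((d−1)/d)·N, then h divides F_s; in other words, there exists a homogeneous polynomial F̃ of degree s−1 such that F_s = F̃·h. -/
open MvPolynomial

noncomputable def ee (a b : ℕ) : Fin 2 →₀ ℕ := Finsupp.single 0 a + Finsupp.single 1 b

@[simp] lemma ee_zero (a b : ℕ) : ee a b 0 = a := by simp [ee]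
@[simp] lemma ee_one (a b : ℕ) : ee a b 1 = b := by simp [ee]
lemma ee_eta (m : Fin 2 →₀ ℕ) : m = ee (m 0) (m 1) := by
  ext j; fin_cases j <;> simp

lemma ee_degree (m : Fin 2 →₀ ℕ) : m.degree = m 0 + m 1 := by
  simp [Finsupp.degree_eq_sum]

/-- coefficient of the Jacobian of a low-weight part vanishes -/
lemma coeff_low (u v : ℕ) (R g : MvPolynomial (Fin 2) ℂ) (E D : ℕ) (p q : Fin 2) (hpq : p ≠ q)
    (hR : ∀ m, coeff m R ≠ 0 → u * m 0 + v * m 1 < E)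
    (hg : ∀ m, coeff m g ≠ 0 → u * m 0 + v * m 1 ≤ D)
    (m : Fin 2 →₀ ℕ) (hm : u * m 0 + v * m 1 + (u + v) = E + D) :
    coeff m (pderiv p R * pderiv q g) = 0 := by
  classical
  rw [coeff_mul]
  refine Finset.sum_eq_zero fun x hx => ?_
  rw [Finset.HasAntidiagonal.mem_antidiagonal] at hx
  rw [coeff_pderiv, coeff_pderiv]
  by_contra hne
  have h1 := hR _ (left_ne_zero_of_mul (left_ne_zero_of_mul hne))
  have h2 := hg _ (left_ne_zero_of_mul (right_ne_zero_of_mul hne))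
  have e0 : x.1 0 + x.2 0 = m 0 := by rw [← hx]; rfl
  have e1 : x.1 1 + x.2 1 = m 1 := by rw [← hx]; rfl
  rw [← e0, ← e1] at hm
  fin_cases p <;> fin_cases q <;> simp [mul_add] at h1 h2 hpq hm <;> omega

lemma chain_rule {n : ℕ} (u v : Fin n → ℂ) (j : Fin 2) (p : MvPolynomial (Fin n) ℂ) :
    pderiv j (aeval (fun k => (C (u k) * X 0 + C (v k) * X 1 : MvPolynomial (Fin 2) ℂ)) p)
    = ∑ k, C (if j = 0 then u k else v k) *
      aeval (fun k => (C (u k) * X 0 + C (v k) * X 1 : MvPolynomial (Fin 2) ℂ)) (pderiv k p) := by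
  induction p using MvPolynomial.induction_on with
  | C a => simp [aeval_C, algebraMap_eq]
  | add p q hp hq => simp only [map_add, hp, hq, mul_add, Finset.sum_add_distrib]
  | mul_X p l hp =>
    rw [map_mul, Derivation.leibniz, hp]
    simp only [Derivation.leibniz, map_add, smul_eq_mul, map_mul, aeval_X, mul_add,
      Finset.sum_add_distrib]
    congr 1
    · rw [Finset.sum_eq_single l]
      · fin_cases j <;> simp [pderiv_X, Derivation.leibniz, mul_comm] 
      · intro b _ hb
        simp [pderiv_X, hb.symm]
      · simp
    · simp only [← mul_add, Finset.mul_sum]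
      refine Finset.sum_congr rfl fun k _ => ?_
      ring

lemma homog_lin {n : ℕ} (u v : Fin n → ℂ) (k : Fin n) :
   (C (u k) * X 0 + C (v k) * X 1 : MvPolynomial (Fin 2) ℂ).IsHomogeneous 1 :=
  (isHomogeneous_C_mul_X _ _).add (isHomogeneous_C_mul_X _ _)

lemma coeff_sub_comp {n : ℕ} (u v : Fin n → ℂ) (p : MvPolynomial (Fin n) ℂ) (m : Fin 2 →₀ ℕ) :
    coeff m (aeval (fun k => (C (u k) * X 0 + C (v k) * X 1 : MvPolynomial (Fin 2) ℂ)) p)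
    = coeff m (aeval (fun k => (C (u k) * X 0 + C (v k) * X 1 : MvPolynomial (Fin 2) ℂ))
      (homogeneousComponent m.degree p)) := by
  conv_lhs => rw [← sum_homogeneousComponent p, map_sum, coeff_sum]
  have key : ∀ i, i ≠ m.degree → coeff m (aeval (fun k => (C (u k) * X 0 + C (v k) * X 1 :
      MvPolynomial (Fin 2) ℂ)) (homogeneousComponent i p)) = 0 := by
    intro i hi
    have := (homogeneousComponent_isHomogeneous i p).aeval _ (homog_lin u v)
    exact this.coeff_eq_zero (by simpa using hi.symm)
  rw [Finset.sum_eq_single m.degree]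
  · intro i _ hi; exact key i hi
  · intro hi
    rw [homogeneousComponent_eq_zero]
    · simp
    · simp at hi; omega

lemma dvd_or_point {n : ℕ} (h f : MvPolynomial (Fin n) ℂ) (hh : h.IsHomogeneous 1) (h0 : h ≠ 0)
    (hf : ∀ v, eval v h = 0 → eval v f = 0) : h ∣ f := by
  classical
  obtain ⟨c, hc⟩ : ∃ c : Fin n → ℂ, h = ∑ k, C (c k) * X k := by
    have : h ∈ homogeneousSubmodule (Fin n) ℂ 1 := hh
    rw [homogeneousSubmodule_one_eq_span_X, Submodule.mem_span_range_iff_exists_fun] at this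
    obtain ⟨c, hc⟩ := this
    exact ⟨c, by rw [← hc]; simp [smul_eq_C_mul]⟩
  obtain ⟨p, hp⟩ : ∃ p, c p ≠ 0 := by
    by_contra! hall
    exact h0 (by rw [hc]; simp [hall])
  let σ : Fin n → MvPolynomial (Fin n) ℂ := fun k => X k - (if k = p then C (c p)⁻¹ * h else 0)
  have h1 : aeval σ f = 0 := by
    apply MvPolynomial.funext
    intro w
    have : eval w (aeval σ f) = eval (fun k => eval w (σ k)) f := by
      rw [← aeval_eq_eval, ← aeval_eq_eval]
      simp only [← AlgHom.comp_apply]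
      congr 1
      ext k
      simp [aeval_eq_eval]
    rw [this, map_zero]
    apply hf
    have hw : ∀ z, eval z h = ∑ k, c k * z k := by intro z; rw [hc]; simp
    rw [hw]
    simp only [σ, map_sub, eval_X, mul_sub, Finset.sum_sub_distrib, apply_ite (eval w), map_mul,
      eval_C, map_zero, mul_ite, mul_zero, Finset.sum_ite_eq', Finset.mem_univ, if_true]
    rw [← hw]
    field_simp
    ring
  have h2 : Ideal.Quotient.mk (Ideal.span {h}) (aeval σ f) = Ideal.Quotient.mk (Ideal.span {h}) f := by
    have : (Ideal.Quotient.mkₐ ℂ (Ideal.span {h})).comp (aeval σ) =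
        (Ideal.Quotient.mkₐ ℂ (Ideal.span {h})) := by
      ext k
      simp only [AlgHom.comp_apply, aeval_X, Ideal.Quotient.mkₐ_eq_mk, σ]
      rw [Ideal.Quotient.eq, Ideal.mem_span_singleton]
      split_ifs <;> simp
    exact DFunLike.congr_fun this f
  rw [h1, map_zero, eq_comm, Ideal.Quotient.eq_zero_iff_mem, Ideal.mem_span_singleton] at h2
  exact h2

lemma homog_quot {n : ℕ} (h f : MvPolynomial (Fin n) ℂ) (s : ℕ) (hs : 1 ≤ s)
    (hh : h.IsHomogeneous 1) (hf : f.IsHomogeneous s) (hd : h ∣ f) :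
    ∃ Ft : MvPolynomial (Fin n) ℂ, Ft.IsHomogeneous (s - 1) ∧ f = Ft * h := by
  obtain ⟨A, rfl⟩ := hd
  refine ⟨homogeneousComponent (s-1) A, homogeneousComponent_isHomogeneous _ _, ?_⟩
  conv_lhs => rw [← homogeneousComponent_eq_self hf, ← sum_homogeneousComponent A, Finset.mul_sum, map_sum]
  have : ∀ i, homogeneousComponent s (h * homogeneousComponent i A) =
      if i = s - 1 then homogeneousComponent i A * h else 0 := by
    intro i
    rw [homogeneousComponent_of_mem (hh.mul (homogeneousComponent_isHomogeneous i A)), mul_comm]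
    exact if_congr (by omega) rfl rfl
  simp only [this]
  rw [Finset.sum_ite_eq']
  split_ifs with hi
  · rfl
  · rw [homogeneousComponent_eq_zero, zero_mul]
    simp at hi; omega

lemma coeff_y {p : MvPolynomial (Fin 2) ℂ} {s : ℕ} (hp : p.IsHomogeneous s) :
    coeff (ee 0 s) p = eval (fun j => if j = 0 then 0 else 1) p := by
  rw [eval_eq']
  simp only [Fin.prod_univ_two]
  rw [Finset.sum_eq_single (ee 0 s)]
  · simp
  · intro m hm hne
    have h1 : s = m.degree := hp.degree_eq_sum_deg_support hm
    rw [ee_degree] at h1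
    have : m 0 ≠ 0 := by
      intro h0
      apply hne
      rw [ee_eta m, h0]; congr 1; omega
    simp [this]
  · intro hm
    simp only [mem_support_iff, not_not] at hm
    simp [hm]

lemma coeff_x_mul (g : MvPolynomial (Fin 2) ℂ) (k A B : ℕ) (c : ℂ) :
    coeff (ee (k + A) B) (monomial (ee k 0) c * pderiv 1 g) = c * (coeff (ee A (B+1)) g * (B+1)) := by
  have : ee (k + A) B = ee k 0 + ee A B := by ext j; fin_cases j <;> simp
  rw [this, coeff_monomial_mul, coeff_pderiv]
  have : ee A B + Finsupp.single 1 1 = ee A (B+1) := by ext j; fin_cases j <;> simp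
  simp [this]

lemma coeff_x_mul_lt (g : MvPolynomial (Fin 2) ℂ) (k A B : ℕ) (c : ℂ) (h : A < k) :
    coeff (ee A B) (monomial (ee k 0) c * g) = 0 := by
  rw [coeff_monomial_mul', if_neg]
  intro hle
  have := hle 0
  simp at this; omega

lemma coeff_y_mul (g : MvPolynomial (Fin 2) ℂ) (k A B : ℕ) (c : ℂ) :
    coeff (ee A (k + B)) (monomial (ee 0 k) c * pderiv 0 g) = c * (coeff (ee (A+1) B) g * (A+1)) := by
  have : ee A (k + B) = ee 0 k + ee A B := by ext j; fin_cases j <;> simp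
  rw [this, coeff_monomial_mul, coeff_pderiv]
  have : ee A B + Finsupp.single 0 1 = ee (A+1) B := by ext j; fin_cases j <;> simp
  simp [this]

lemma coeff_y_mul_lt (g : MvPolynomial (Fin 2) ℂ) (k A B : ℕ) (c : ℂ) (h : B < k) :
    coeff (ee A B) (monomial (ee 0 k) c * g) = 0 := by
  rw [coeff_monomial_mul', if_neg]
  intro hle
  have := hle 1
  simp at this; omega

/-- The planar case; here `d = e + 2`. -/
lemma planar (f g : MvPolynomial (Fin 2) ℂ) (e N i : ℕ)
    (hf : ∀ m, coeff m f ≠ 0 → m ≠ ee (e+2) 0 → m ≠ ee 0 (e+1) →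
      (e+1) * m 0 + (e+2) * m 1 < (e+2) * (e+1))
    (hf1 : coeff (ee (e+2) 0) f ≠ 0) (hf2 : coeff (ee 0 (e+1)) f ≠ 0)
    (hg : ∀ m, coeff m g ≠ 0 → m 0 + m 1 ≤ N) (hg1 : coeff (ee N 0) g ≠ 0)
    (hi : (e+2) * i < (e+1) * N)
    (hJ : ∀ m : Fin 2 →₀ ℕ, e + i ≤ m 0 + m 1 →
      coeff m (pderiv 0 f * pderiv 1 g - pderiv 1 f * pderiv 0 g) = 0) :
    (e + 2) ∣ N := by
  classical
  set α := coeff (ee (e+2) 0) f with hα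
  set β := coeff (ee 0 (e+1)) f with hβ
  obtain ⟨M, hM, hmax⟩ := Finset.exists_max_image g.support
    (fun m => (e+1) * m 0 + (e+2) * m 1) ⟨ee N 0, by simpa using hg1⟩
  set D := (e+1) * M 0 + (e+2) * M 1 with hD
  have hDN : (e+1) * N ≤ D := by
    have := hmax (ee N 0) (by simpa using hg1)
    simpa using this
  have hgD : ∀ m, coeff m g ≠ 0 → (e+1) * m 0 + (e+2) * m 1 ≤ D := fun m hm =>
    hmax m (by simpa using hm)
  have hne : ee (e+2) 0 ≠ ee 0 (e+1) := fun h => by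
    have := DFunLike.congr_fun h 0
    simp at this
  obtain ⟨R, hR⟩ : ∃ R, f = monomial (ee (e+2) 0) α + monomial (ee 0 (e+1)) β + R :=
    ⟨f - (monomial (ee (e+2) 0) α + monomial (ee 0 (e+1)) β), by ring⟩
  have hRw : ∀ m, coeff m R ≠ 0 → (e+1) * m 0 + (e+2) * m 1 < (e+2) * (e+1) := by
    intro m hm
    have hR' : R = f - (monomial (ee (e+2) 0) α + monomial (ee 0 (e+1)) β) := by rw [hR]; ring
    by_cases h1 : m = ee (e+2) 0
    · exfalso; apply hm; subst h1
      rw [hR']; simp [coeff_monomial, hne.symm, hα]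
    by_cases h2 : m = ee 0 (e+1)
    · exfalso; apply hm; subst h2
      rw [hR']; simp [coeff_monomial, hne, hβ]
    refine hf m ?_ h1 h2
    rw [hR'] at hm
    simpa [coeff_monomial, Ne.symm h1, Ne.symm h2] using hm
  have d0 : pderiv 0 f = monomial (ee (e+1) 0) (α * (e+2)) + pderiv 0 R := by
    conv_lhs => rw [hR]
    have : ee (e+2) 0 - Finsupp.single 0 1 = ee (e+1) 0 := by ext j; fin_cases j <;> simp
    simp [pderiv_monomial, this]
  have d1 : pderiv 1 f = monomial (ee 0 e) (β * (e+1)) + pderiv 1 R := by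
    conv_lhs => rw [hR]
    have : ee 0 (e+1) - Finsupp.single 1 1 = ee 0 e := by ext j; fin_cases j <;> simp
    simp [pderiv_monomial, this]
  have key : ∀ A B, (e+1) * A + (e+2) * B + (e + 1 + (e + 2)) = (e+2)*(e+1) + D →
      coeff (ee A B) (monomial (ee (e+1) 0) (α * (e+2)) * pderiv 1 g) =
      coeff (ee A B) (monomial (ee 0 e) (β * (e+1)) * pderiv 0 g) := by
    intro A B hAB
    have h1 := hJ (ee A B) (by
      simp only [ee_zero, ee_one]
      by_contra hlt
      nlinarith)
    rw [d0, d1] at h1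
    have h2 := coeff_low (e+1) (e+2) R g _ D 0 1 (by decide) hRw hgD (ee A B) (by simpa using hAB)
    have h3 := coeff_low (e+1) (e+2) R g _ D 1 0 (by decide) hRw hgD (ee A B) (by simpa using hAB)
    simp only [add_mul, coeff_sub, coeff_add, h2, h3, add_zero] at h1
    exact sub_eq_zero.mp h1
  have e1 : ((e:ℂ) + 1) ≠ 0 := by exact_mod_cast Nat.succ_ne_zero e
  have e2 : ((e:ℂ) + 2) ≠ 0 := by exact_mod_cast Nat.succ_ne_zero (e+1)
  -- going down in y
  have down : ∀ b a, coeff (ee a b) g ≠ 0 → (e+1) * a + (e+2) * b = D →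
      ∃ a', coeff (ee a' 0) g ≠ 0 ∧ (e+1) * a' = D := by
    intro b
    induction b using Nat.strong_induction_on with
    | _ b ih =>
      intro a hab hw
      rcases Nat.eq_zero_or_pos b with rfl | hb
      · exact ⟨a, hab, by simpa using hw⟩
      obtain ⟨b, rfl⟩ : ∃ b', b = b' + 1 := ⟨b - 1, by omega⟩
      have hk := key (e + 1 + a) b (by rw [← hw]; ring)
      rw [coeff_x_mul] at hk
      have hl : α * (e+2) * (coeff (ee a (b+1)) g * (b+1)) ≠ 0 := by
        have : ((b:ℂ)+1) ≠ 0 := by exact_mod_cast Nat.succ_ne_zero b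
        exact mul_ne_zero (mul_ne_zero hf1 e2) (mul_ne_zero hab this)
      rw [hk] at hl
      by_cases hbe : b < e
      · exact absurd (coeff_y_mul_lt _ _ _ _ _ hbe) hl
      obtain ⟨c, rfl⟩ : ∃ c, b = e + c := ⟨b - e, by omega⟩
      rw [coeff_y_mul] at hl
      refine ih c (by omega) (e+1+a+1) (left_ne_zero_of_mul (right_ne_zero_of_mul hl)) ?_
      rw [← hw]; ring
  have hDeq : D = (e+1) * N := by
    obtain ⟨a', h1, h2⟩ := down (M 1) (M 0) (by rw [← ee_eta]; simpa using hM) rfl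
    have := hg _ h1
    simp at this
    nlinarith
  have up : ∀ a b, coeff (ee a b) g ≠ 0 → (e+1) * a + (e+2) * b = D → (e + 2) ∣ a := by
    intro a
    induction a using Nat.strong_induction_on with
    | _ a ih =>
      intro b hab hw
      rcases Nat.eq_zero_or_pos a with rfl | ha
      · simp
      obtain ⟨a, rfl⟩ : ∃ a', a = a' + 1 := ⟨a - 1, by omega⟩
      have hk := key a (e + b) (by rw [← hw]; ring)
      rw [coeff_y_mul] at hk
      have hl : β * (e+1) * (coeff (ee (a+1) b) g * (a+1)) ≠ 0 := by
        have : ((a:ℂ)+1) ≠ 0 := by exact_mod_cast Nat.succ_ne_zero a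
        exact mul_ne_zero (mul_ne_zero hf2 e1) (mul_ne_zero hab this)
      rw [← hk] at hl
      by_cases hbe : a < e + 1
      · exact absurd (coeff_x_mul_lt _ _ _ _ _ hbe) hl
      obtain ⟨c, rfl⟩ : ∃ c, a = e + 1 + c := ⟨a - (e+1), by omega⟩
      rw [coeff_x_mul] at hl
      have := ih c (by omega) (e+b+1) (left_ne_zero_of_mul (right_ne_zero_of_mul hl))
        (by rw [← hw]; ring)
      rw [show e + 1 + c + 1 = (e + 2) + c by ring]
      exact (Nat.dvd_add_right (dvd_refl _)).mpr this
  exact up N 0 hg1 (by rw [hDeq]; ring)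

theorem stmt_7 {n : ℕ} (F G h : MvPolynomial (Fin n) ℂ) (d N s : ℕ) (aN : ℂ)
    (hd : 2 ≤ d) (hdN : d ≤ N) (hs : s = d - 1)
    (hFdeg : F.totalDegree = d) (hGdeg : G.totalDegree = N)
    (hF0 : MvPolynomial.coeff 0 F = 0) (hG0 : MvPolynomial.coeff 0 G = 0)
    (hh : h.IsHomogeneous 1)
    (hFd : homogeneousComponent d F = h ^ d)
    (haN : aN ≠ 0) (hGN : homogeneousComponent N G = aN • h ^ N)
    (hNd : ¬ d ∣ N)
    (i : ℕ) (hi : 1 ≤ i) (hiN : (i : ℚ) < ((d : ℚ) - 1) / d * N)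
    (hdeg : PoissonDegLT F G ((d : ℤ) + i)) :
    ∃ Ft : MvPolynomial (Fin n) ℂ, Ft.IsHomogeneous (s - 1) ∧
      homogeneousComponent s F = Ft * h := by
  classical
  obtain ⟨e, rfl⟩ : ∃ e, d = e + 2 := ⟨d - 2, by omega⟩
  obtain rfl : s = e + 1 := by omega
  have h0 : h ≠ 0 := by
    rintro rfl
    have hF : F ≠ 0 := by rintro rfl; simp at hFdeg
    obtain ⟨m, hm, hmd⟩ := F.support.exists_mem_eq_sup (by simpa using hF) (fun m => m.degree)
    have h1 : m.degree = e + 2 := by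
      rw [← hmd, ← hFdeg, totalDegree]; rfl
    have h2 := coeff_homogeneousComponent (e+2) F m
    rw [hFd, if_pos h1] at h2
    simp at h2 hm
    exact hm h2.symm
  apply homog_quot h _ _ (by omega) hh (homogeneousComponent_isHomogeneous _ _)
  apply dvd_or_point h _ hh h0
  intro v hv
  by_contra hFv
  apply hNd
  obtain ⟨u, hu⟩ : ∃ u, eval u h = 1 := by
    obtain ⟨w, hw⟩ : ∃ w, eval w h ≠ 0 := by
      by_contra! hall
      exact h0 (MvPolynomial.funext (by simpa using hall))
    refine ⟨fun k => (eval w h)⁻¹ * w k, ?_⟩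
    obtain ⟨c, hc⟩ : ∃ c : Fin n → ℂ, h = ∑ k, C (c k) * X k := by
      have : h ∈ homogeneousSubmodule (Fin n) ℂ 1 := hh
      rw [homogeneousSubmodule_one_eq_span_X, Submodule.mem_span_range_iff_exists_fun] at this
      obtain ⟨c, hc⟩ := this
      exact ⟨c, by rw [← hc]; simp [smul_eq_C_mul]⟩
    have hz : ∀ z, eval z h = ∑ k, c k * z k := by intro z; rw [hc]; simp
    rw [hz (fun k => (eval w h)⁻¹ * w k)]
    have hr : ∀ k, c k * ((eval w h)⁻¹ * w k) = (eval w h)⁻¹ * (c k * w k) := fun k => by ring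
    simp only [hr]
    rw [← Finset.mul_sum]
    rw [← hz, inv_mul_cancel₀ hw]
  set φ : MvPolynomial (Fin n) ℂ →ₐ[ℂ] MvPolynomial (Fin 2) ℂ :=
    aeval (fun k => (C (u k) * X 0 + C (v k) * X 1 : MvPolynomial (Fin 2) ℂ)) with hφ
  have hom : ∀ k p, (homogeneousComponent k p : MvPolynomial (Fin n) ℂ).IsHomogeneous k →
      (φ (homogeneousComponent k p)).IsHomogeneous k := by
    intro k p hk
    have := hk.aeval _ (homog_lin u v)
    rwa [one_mul] at this
  have evalφ : ∀ p x y, eval (fun j => if j = 0 then x else y) (φ p) =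
      eval (fun k => u k * x + v k * y) p := by
    intro p x y
    rw [← aeval_eq_eval, ← aeval_eq_eval, hφ]
    simp only [← AlgHom.comp_apply]
    congr 1
    ext k
    simp [aeval_eq_eval]
  have hφh : φ h = X 0 := by
    obtain ⟨c, hc⟩ : ∃ c : Fin n → ℂ, h = ∑ k, C (c k) * X k := by
      have : h ∈ homogeneousSubmodule (Fin n) ℂ 1 := hh
      rw [homogeneousSubmodule_one_eq_span_X, Submodule.mem_span_range_iff_exists_fun] at this
      obtain ⟨c, hc⟩ := this
      exact ⟨c, by rw [← hc]; simp [smul_eq_C_mul]⟩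
    have hw : ∀ z, eval z h = ∑ k, c k * z k := by intro z; rw [hc]; simp
    rw [hw] at hv hu
    have : φ h = C (∑ k, c k * u k) * X 0 + C (∑ k, c k * v k) * X 1 := by
      rw [hc]
      simp only [map_sum, map_mul, hφ, aeval_X, aeval_C, algebraMap_eq, Finset.sum_mul,
        ← Finset.sum_add_distrib]
      refine Finset.sum_congr rfl fun k _ => by ring
    rw [this, hv, hu]; simp
  have hXpow : ∀ k, (X 0 ^ k : MvPolynomial (Fin 2) ℂ) = monomial (ee k 0) 1 := by
    intro k; rw [X_pow_eq_monomial]; simp [ee]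
  have hlow : ∀ p m, coeff m (φ p) ≠ 0 → m 0 + m 1 ≤ p.totalDegree := by
    intro p m hm
    by_contra hlt
    apply hm
    rw [coeff_sub_comp, homogeneousComponent_eq_zero]
    · simp
    · rw [ee_degree]; omega
  have cFtop : ∀ m, m.degree = e + 2 → coeff m (φ F) = coeff m (monomial (ee (e+2) 0) (1:ℂ)) := by
    intro m hm
    rw [coeff_sub_comp, hm, hFd, map_pow, ← hφ, hφh, hXpow]
  apply planar (φ F) (φ G) e N i
  · intro m hm h1 h2
    have h3 := hlow _ _ hm
    rw [hFdeg] at h3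
    rcases Nat.lt_or_ge (m 0 + m 1) (e + 2) with h4 | h4
    · have h5 : m 0 = 0 → m 1 ≠ e + 1 := by
        intro h5 h6
        exact h2 (by rw [ee_eta m, h5, h6])
      rcases Nat.eq_zero_or_pos (m 0) with h6 | h6
      · have := h5 h6
        have : m 1 ≤ e := by omega
        rw [h6]; nlinarith
      · have : m 0 + m 1 ≤ e + 1 := by omega
        nlinarith
    · exfalso
      rw [cFtop m (by rw [ee_degree]; omega), coeff_monomial, if_neg (Ne.symm h1)] at hm
      exact hm rfl
  · rw [cFtop _ (by rw [ee_degree]; simp)]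
    simp [coeff_monomial]
  · rw [coeff_sub_comp, ee_degree, ← hφ]
    simp only [ee_zero, ee_one, zero_add]
    rw [coeff_y (hom _ _ (homogeneousComponent_isHomogeneous _ _)), evalφ]
    simpa using hFv
  · intro m hm
    rw [← hGdeg]; exact hlow _ _ hm
  · rw [coeff_sub_comp, ee_degree, ← hφ]
    simp only [ee_zero, ee_one, add_zero]
    rw [hGN, map_smul, map_pow, hφh, hXpow]
    simpa [coeff_monomial] using haN
  · have hpos : (0:ℚ) < ((e + 2 : ℕ) : ℚ) := by positivity
    rw [div_mul_eq_mul_div, lt_div_iff₀ hpos] at hiN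
    push_cast at hiN
    have : (((e+2) * i : ℕ) : ℚ) < (((e+1) * N : ℕ) : ℚ) := by
      push_cast; linarith
    exact_mod_cast this
  · intro m hm
    have hJ : pderiv 0 (φ F) * pderiv 1 (φ G) - pderiv 1 (φ F) * pderiv 0 (φ G) =
        ∑ p, ∑ q, C (u p * v q) * φ (pderiv p F * pderiv q G - pderiv q F * pderiv p G) := by
      rw [hφ]
      simp only [chain_rule]
      rw [← hφ, Finset.sum_mul_sum, Finset.sum_mul_sum]
      conv_lhs => 
        arg 2
        rw [Finset.sum_comm]
      simp only [← Finset.sum_sub_distrib]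
      refine Finset.sum_congr rfl fun p _ => Finset.sum_congr rfl fun q _ => ?_
      simp only [map_sub, map_mul]
      simp
      ring
    rw [hJ, coeff_sum]
    refine Finset.sum_eq_zero fun p _ => ?_
    rw [coeff_sum]
    refine Finset.sum_eq_zero fun q _ => ?_
    rw [coeff_C_mul]
    rcases hdeg p q with hz | hlt
    · rw [hz]; simp
    · by_contra hne
      have := hlow _ _ (right_ne_zero_of_mul hne)
      push_cast at hlt
      omega
end

section
/- Let d ≥ 2 be an integer, s = d−1, let k ∈ ℕ satisfy d > 2k, and let j, N be integers with 1 ≤ j < N. Then the minimum of α₀ + k·α_s over all tuples (α₀,α₁,…,α_s) ∈ Z_{j,N,d} equals (d−k)·j − (s−k)·N, and this minimum is attained at exactly one point, namely (d·j − s·N, 0, …, 0, N−j) (with N−j in the last coordinate). -/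
theorem Zset_key (s : ℕ) (j N k : ℤ) (hs : 0 < s) (hk : 2 * k ≤ s)
    (α : ℤ × (Fin s → ℕ)) (h : α ∈ Zset s j N (s + 1)) :
    ∃ B C : ℤ, B = ∑ l ∈ Finset.univ.erase (⟨s - 1, by omega⟩ : Fin s), (α.2 l : ℤ) ∧
      0 ≤ B ∧ 0 ≤ C ∧ C ≤ (s - 1) * B ∧
      α.1 + (C + s * α.2 ⟨s - 1, by omega⟩) = j ∧
      α.1 + (s + 1) * (B + α.2 ⟨s - 1, by omega⟩) ≤ N ∧
      ((s : ℤ) + 1 - k) * j - (s - k) * N + B ≤ α.1 + k * α.2 ⟨s - 1, by omega⟩ := by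
  obtain ⟨h1, h2⟩ := h
  have hm : (⟨s - 1, by omega⟩ : Fin s) ∈ Finset.univ := Finset.mem_univ _
  rw [← Finset.sum_erase_add _ _ hm] at h1 h2
  have hl : (((⟨s - 1, by omega⟩ : Fin s) : ℕ) : ℤ) + 1 = s := by
    simp only []
    omega
  rw [hl] at h1
  have hB : 0 ≤ ∑ l ∈ Finset.univ.erase (⟨s - 1, by omega⟩ : Fin s), (α.2 l : ℤ) :=
    Finset.sum_nonneg fun l _ => by positivity
  have hC0 : 0 ≤ ∑ l ∈ Finset.univ.erase (⟨s - 1, by omega⟩ : Fin s),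
      ((l : ℤ) + 1) * (α.2 l : ℤ) :=
    Finset.sum_nonneg fun l _ => by positivity
  have hC : ∑ l ∈ Finset.univ.erase (⟨s - 1, by omega⟩ : Fin s), ((l : ℤ) + 1) * (α.2 l : ℤ)
      ≤ (s - 1) * ∑ l ∈ Finset.univ.erase (⟨s - 1, by omega⟩ : Fin s), (α.2 l : ℤ) := by
    rw [Finset.mul_sum]
    refine Finset.sum_le_sum fun l hl => ?_
    have hne := Finset.ne_of_mem_erase hl
    have h3 : (l : ℕ) ≠ s - 1 := fun h => hne (Fin.ext h)
    have h4 := l.2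
    have h5 : ((l : ℕ) : ℤ) + 1 ≤ s - 1 := by omega
    exact mul_le_mul_of_nonneg_right h5 (by positivity)
  refine ⟨_, _, rfl, hB, hC0, hC, h1, h2, ?_⟩
  generalize (∑ l ∈ Finset.univ.erase (⟨s - 1, by omega⟩ : Fin s), (α.2 l : ℤ)) = B at *
  generalize (∑ l ∈ Finset.univ.erase (⟨s - 1, by omega⟩ : Fin s),
    ((l : ℤ) + 1) * (α.2 l : ℤ)) = C at *
  generalize ((α.2 ⟨s - 1, by omega⟩ : ℕ) : ℤ) = A at *
  have hsk : (0 : ℤ) ≤ s - k := by omega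
  have e1 := mul_le_mul_of_nonneg_left h2 hsk
  have e2 := mul_le_mul_of_nonneg_left hC hsk
  have e3 : 0 ≤ ((s : ℤ) - 2 * k) * B := mul_nonneg (by omega) hB
  have h0 : α.1 = j - (C + s * A) := by linarith
  rw [h0] at e1 ⊢
  nlinarith

theorem stmt_9 (d j N k : ℕ) (hd : 2 ≤ d) (s : ℕ) (hs : s = d - 1)
    (hk : 2 * k < d) (hj : 1 ≤ j) (hjN : j < N) :
    (∀ α ∈ Zset s j N d,
        ((d : ℤ) - k) * j - ((s : ℤ) - k) * N ≤ α.1 + k * α.2 ⟨s - 1, by omega⟩) ∧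
    (((d : ℤ) * j - s * N, fun l : Fin s => if (l : ℕ) = s - 1 then N - j else 0)
        ∈ Zset s j N d) ∧
    ((((d : ℤ) * j - s * N, fun l : Fin s => if (l : ℕ) = s - 1 then N - j else 0) :
        ℤ × (Fin s → ℕ)).1 +
      k * (((d : ℤ) * j - s * N, fun l : Fin s => if (l : ℕ) = s - 1 then N - j else 0) :
        ℤ × (Fin s → ℕ)).2 ⟨s - 1, by omega⟩ =
      ((d : ℤ) - k) * j - ((s : ℤ) - k) * N) ∧
    (∀ α ∈ Zset s j N d,
      α.1 + k * α.2 ⟨s - 1, by omega⟩ = ((d : ℤ) - k) * j - ((s : ℤ) - k) * N →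
      α = ((d : ℤ) * j - s * N,
            fun l : Fin s => if (l : ℕ) = s - 1 then N - j else 0)) := by
  have hd' : (d : ℤ) = s + 1 := by omega
  have hsp : 0 < s := by omega
  have hk' : 2 * (k : ℤ) ≤ s := by omega
  rw [hd']
  have hcast : ((N - j : ℕ) : ℤ) = N - j := by omega
  have hiff : ∀ l : Fin s, (l : ℕ) = s - 1 ↔ l = ⟨s - 1, by omega⟩ := fun l => by
    rw [Fin.ext_iff]
  refine ⟨?_, ?_, ?_, ?_⟩
  · intro α hα
    obtain ⟨B, C, -, hB, -, -, -, -, h⟩ := Zset_key s j N k hsp hk' α hα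
    linarith
  · have hl : ((s - 1 : ℕ) : ℤ) + 1 = s := by omega
    simp only [Zset, Set.mem_setOf_eq, hiff, Nat.cast_ite, Nat.cast_zero, mul_ite, mul_zero,
      Finset.sum_ite_eq', Finset.mem_univ, if_true, hcast, hl]
    constructor
    · ring
    · apply le_of_eq
      ring
  · simp only [if_true, hcast]
    ring
  · intro α hα heq
    obtain ⟨B, C, hBd, hB, hC0, hC, h1, h2, h⟩ := Zset_key s j N k hsp hk' α hα
    have hB0 : B = 0 := by linarith
    have hCz : C = 0 := by
      rw [hB0] at hC
      linarith
    rw [hB0] at hBd h2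
    rw [hCz] at h1
    have hz := (Finset.sum_eq_zero_iff_of_nonneg (fun l _ => by positivity)).1 hBd.symm
    have hsk : (0 : ℤ) < s - k := by omega
    have hA : ((α.2 ⟨s - 1, by omega⟩ : ℕ) : ℤ) = N - j := by
      have : ((s : ℤ) - k) * (α.2 ⟨s - 1, by omega⟩ : ℕ) = (s - k) * (N - j) := by
        linear_combination h1 - heq
      exact mul_left_cancel₀ hsk.ne' this
    refine Prod.ext ?_ (funext fun l => ?_)
    · rw [hA] at h1
      linear_combination h1
    · by_cases hl : (l : ℕ) = s - 1
      · have := (hiff l).1 hl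
        subst this
        simp only [if_true]
        omega
      · simp only [hl, if_false]
        have := hz l (Finset.mem_erase.2 ⟨fun h => hl ((hiff l).2 h), Finset.mem_univ _⟩)
        exact_mod_cast this
end

section
/- Assume the setup with deg h = 1, and let k ∈ ℕ satisfy 2k < d. If N is not congruent to 0 modulo d and deg[F,G] < d + i for some positive integer i with i < ((s−k)/(d−k))·N, then h^{k+1} divides F_s; in other words, there exists a homogeneous polynomial F̃ of degree s−k−1 such that F_s = F̃·h^{k+1}. -/
open MvPolynomial

lemma aux_comp_mul {σ : Type*} (p q : MvPolynomial σ ℂ) (M : ℕ) :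
    homogeneousComponent M (p * q) = ∑ x ∈ Finset.HasAntidiagonal.antidiagonal M,
      homogeneousComponent x.1 p * homogeneousComponent x.2 q := by
  classical
  ext m
  rw [coeff_homogeneousComponent, coeff_sum]
  simp_rw [coeff_mul, coeff_homogeneousComponent]
  rw [Finset.sum_comm]
  have key : ∀ y ∈ Finset.HasAntidiagonal.antidiagonal m,
      (∑ x ∈ Finset.HasAntidiagonal.antidiagonal M, (if y.1.degree = x.1 then coeff y.1 p else 0) *
        (if y.2.degree = x.2 then coeff y.2 q else 0)) =
      if m.degree = M then coeff y.1 p * coeff y.2 q else 0 := by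
    intro y hy
    have hm : m.degree = y.1.degree + y.2.degree := by
      rw [← Finset.HasAntidiagonal.mem_antidiagonal.mp hy, map_add]
    split_ifs with h
    · rw [Finset.sum_eq_single (y.1.degree, y.2.degree)]
      · simp
      · rintro ⟨a, b⟩ _ hne
        by_cases h1 : y.1.degree = a
        · by_cases h2 : y.2.degree = b
          · exact absurd (by rw [h1, h2]) hne
          · simp [h2]
        · simp [h1]
      · intro hh
        exact absurd (by rw [Finset.HasAntidiagonal.mem_antidiagonal]; omega) hh
    · apply Finset.sum_eq_zero
      rintro ⟨a, b⟩ hab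
      rw [Finset.HasAntidiagonal.mem_antidiagonal] at hab
      by_cases h1 : y.1.degree = a
      · by_cases h2 : y.2.degree = b
        · exact absurd (by simp at hab; omega) h
        · simp [h2]
      · simp [h1]
  rw [Finset.sum_congr rfl key]
  split_ifs <;> simp

lemma aux_comp_pderiv {σ : Type*} (p : σ) (F : MvPolynomial σ ℂ) (M : ℕ) :
    homogeneousComponent M (pderiv p F) = pderiv p (homogeneousComponent (M + 1) F) := by
  classical
  ext m
  simp only [coeff_homogeneousComponent, coeff_pderiv, map_add, Finsupp.degree_single]
  by_cases h : m.degree = M <;> simp [h]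

lemma aux_comp_mul_homog {σ : Type*} (Q g : MvPolynomial σ ℂ) (e j : ℕ) (hg : g.IsHomogeneous j) :
    homogeneousComponent (e + j) (Q * g) = homogeneousComponent e Q * g := by
  rw [aux_comp_mul, Finset.sum_eq_single (e, j)]
  · rw [homogeneousComponent_eq_self hg]
  · rintro ⟨a, b⟩ hab hne
    rw [Finset.HasAntidiagonal.mem_antidiagonal] at hab
    rw [homogeneousComponent_of_mem hg, if_neg, mul_zero]
    simp only at hab ⊢
    rintro rfl
    exact hne (by simpa using hab)
  · intro hh
    exact absurd (by simp) hh

set_option linter.unusedSectionVars false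
section abstr
variable {R : Type*} [CommRing R] [IsDomain R] [Algebra ℂ R] (E D : Derivation ℂ R R) (h : R)

lemma aux_D_pow (hD : D h = 0) (j : ℕ) (u : R) : D (h ^ j * u) = h ^ j * D u := by
  simp [Derivation.leibniz, Derivation.leibniz_pow, hD]

lemma aux_E_pow (hE : E h = 1) (j : ℕ) (u : R) :
    h * E (h ^ j * u) = h ^ j * (h * E u) + (j : R) * (h ^ j * u) := by
  simp only [Derivation.leibniz, Derivation.leibniz_pow, hE, smul_eq_mul, nsmul_eq_mul, mul_one]
  cases j with
  | zero => simp
  | succ j => simp only [Nat.add_sub_cancel]; ring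

lemma aux_term (hE : E h = 1) (hD : D h = 0) (Δ a b A B : ℕ) (f g : R)
    (hf : h ^ A ∣ h ^ (Δ * a) * f) (hg : h ^ B ∣ h ^ (Δ * b) * g) :
    h ^ (A + B) ∣ h ^ (Δ * (a + b) + 1) * (E f * D g - D f * E g) := by
  obtain ⟨u, hu⟩ := hf
  obtain ⟨v, hv⟩ := hg
  have e1 := aux_E_pow E h hE (Δ * a) f
  have e2 := aux_E_pow E h hE (Δ * b) g
  have e3 := aux_D_pow D h hD (Δ * a) f
  have e4 := aux_D_pow D h hD (Δ * b) g
  rw [hu] at e1 e3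
  rw [hv] at e2 e4
  rw [aux_E_pow E h hE] at e1 e2
  rw [aux_D_pow D h hD] at e3 e4
  refine ⟨(h * E u + A * u - (Δ * a : ℕ) * u) * D v - D u * (h * E v + B * v - (Δ * b : ℕ) * v), ?_⟩
  have : h ^ (Δ * (a + b) + 1) * (E f * D g - D f * E g) =
    (h ^ (Δ * a) * (h * E f)) * (h ^ (Δ * b) * D g) -
      (h ^ (Δ * a) * D f) * (h ^ (Δ * b) * (h * E g)) := by ring
  rw [this, ← e3, ← e4, eq_sub_of_add_eq e1.symm, eq_sub_of_add_eq e2.symm]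
  ring

/-- the first order term -/
lemma aux_term1 (hE : E h = 1) (hD : D h = 0) (Δ m d N b : ℕ) (hΔ : Δ + m = d) (f g : R) (c : ℂ)
    (hg : h ^ (N + 1) ∣ h ^ (Δ * b) * g - algebraMap ℂ R c * f ^ b * h ^ N) :
    h ^ (d + N + 1) ∣ h ^ (Δ * (b + 1) + 1) * (E (h ^ m * f) * D g - D (h ^ m * f) * E g)
      - h ^ (d + N) * algebraMap ℂ R c * ((d : R) * b - N) * f ^ b * D f := by
  obtain ⟨r, hr⟩ := hg
  have hv : h ^ (Δ * b) * g = h ^ N * (algebraMap ℂ R c * f ^ b + h * r) := by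
    linear_combination hr
  have e1 := aux_E_pow E h hE m f
  have e2 := aux_E_pow E h hE (Δ * b) g
  have e3 := aux_D_pow D h hD m f
  have e4 := aux_D_pow D h hD (Δ * b) g
  have e5 : f * D (f ^ b) = b * f ^ b * D f := by
    simp only [Derivation.leibniz_pow, smul_eq_mul, nsmul_eq_mul]
    cases b with
    | zero => simp
    | succ j => simp only [Nat.add_sub_cancel]; ring
  have e6 : D (algebraMap ℂ R c * f ^ b + h * r) = algebraMap ℂ R c * D (f ^ b) + h * D r := by
    simp [Derivation.leibniz, hD]
  rw [hv, aux_E_pow E h hE] at e2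
  rw [hv, aux_D_pow D h hD, e6] at e4
  set v := algebraMap ℂ R c * f ^ b + h * r with hvdef
  set κ := algebraMap ℂ R c
  have : h ^ (Δ * (b + 1) + 1) * (E (h ^ m * f) * D g - D (h ^ m * f) * E g) =
    h ^ Δ * ((h * E (h ^ m * f)) * (h ^ (Δ * b) * D g) -
      D (h ^ m * f) * (h ^ (Δ * b) * (h * E g))) := by ring
  rw [this, ← e4, eq_sub_of_add_eq e2.symm, e1, e3, ← hΔ]
  refine ⟨E f * (κ * D (f ^ b) + h * D r) + m * f * D r - D f * (E v + N * r - (Δ * b : ℕ) * r), ?_⟩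
  rw [hvdef]
  push_cast
  linear_combination (h ^ (Δ + m + N) * κ * m) * e5

lemma aux_step (hE : E h = 1) (hD : D h = 0) (hh : h ≠ 0) (Fc Gc : ℕ → R) (Δ m d N b M : ℕ)
    (hd : 2 ≤ d) (hΔ : Δ + m = d)
    (hm : 2 * m < d) (f : R) (c : ℕ → ℂ) (hFd : Fc d = h ^ d) (hFs : Fc (d - 1) = h ^ m * f)
    (hF0 : ∀ j, d < j → Fc j = 0) (hG0 : ∀ j, N < j → Gc j = 0)
    (hb : b + 1 ≤ N - 1) (hN : 1 ≤ N) (hM : M + (b + 1) + 2 = d + N)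
    (hc : c (b + 1) * (d * (b + 1)) = (N - d * b) * c b)
    (hsum : ∑ x ∈ Finset.HasAntidiagonal.antidiagonal M,
      (E (Fc (x.1 + 1)) * D (Gc (x.2 + 1)) - D (Fc (x.1 + 1)) * E (Gc (x.2 + 1))) = 0)
    (IH : ∀ b' ≤ b, h ^ (N + 1) ∣
      h ^ (Δ * b') * Gc (N - b') - algebraMap ℂ R (c b') * f ^ b' * h ^ N) :
    h ^ (N + 1) ∣ D (h ^ (Δ * (b + 1)) * Gc (N - (b + 1)) -
      algebraMap ℂ R (c (b + 1)) * f ^ (b + 1) * h ^ N) := by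
  classical
  set t : ℕ × ℕ → R := fun x =>
    (E (Fc (x.1 + 1)) * D (Gc (x.2 + 1)) - D (Fc (x.1 + 1)) * E (Gc (x.2 + 1))) with ht
  set S := Finset.HasAntidiagonal.antidiagonal M with hS
  have hx0 : (d - 1, N - 1 - (b + 1)) ∈ S := by
    rw [hS, Finset.HasAntidiagonal.mem_antidiagonal]; simp only; omega
  have hx1 : (d - 2, N - 1 - b) ∈ S.erase (d - 1, N - 1 - (b + 1)) := by
    rw [Finset.mem_erase, hS, Finset.HasAntidiagonal.mem_antidiagonal]
    refine ⟨fun h => ?_, by simp only; omega⟩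
    have := congrArg Prod.fst h
    simp only at this; omega
  have h1 := Finset.add_sum_erase S t hx0
  have h2 := Finset.add_sum_erase _ t hx1
  change ∑ x ∈ S, t x = 0 at hsum
  rw [hsum, ← h2] at h1
  have hrest : h ^ (d + N + 1) ∣ h ^ (Δ * (b + 1) + 1) *
      ∑ x ∈ (S.erase (d - 1, N - 1 - (b + 1))).erase (d - 2, N - 1 - b), t x := by
    rw [Finset.mul_sum]
    apply Finset.dvd_sum
    rintro ⟨α, β⟩ hx
    simp only [Finset.mem_erase, hS, Finset.HasAntidiagonal.mem_antidiagonal, ne_eq, Prod.mk.injEq] at hx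
    obtain ⟨n1, n0, hab⟩ := hx
    simp only [ht]
    by_cases hα : d < α + 1
    · simp [hF0 _ hα]
    by_cases hβ : N < β + 1
    · simp [hG0 _ hβ]
    have ha0 : α + 1 ≠ d := fun hh => n0 (by omega)
    have ha1 : α + 2 ≠ d := fun hh => n1 (by omega)
    obtain ⟨a, ha⟩ : ∃ a, α + 1 + a = d := ⟨d - (α + 1), by omega⟩
    obtain ⟨b', hb'⟩ : ∃ b', β + 1 + b' = N := ⟨N - (β + 1), by omega⟩
    have hab' : b + 1 = a + b' := by omega
    have ha2 : 2 ≤ a := by omega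
    have hG := IH b' (by omega)
    have hG' : h ^ N ∣ h ^ (Δ * b') * Gc (β + 1) := by
      rw [show N - b' = β + 1 by omega] at hG
      have := (pow_dvd_pow h (Nat.le_succ N)).trans hG
      rwa [dvd_sub_left (Dvd.intro_left _ rfl)] at this
    have hF' : h ^ (d + 1) ∣ h ^ (Δ * a) * Fc (α + 1) := by
      apply Dvd.dvd.mul_right
      apply pow_dvd_pow
      nlinarith
    rw [hab']
    convert aux_term E D h hE hD Δ a b' (d + 1) N _ _ hF' hG' using 2
    ring
  have hT1 := aux_term1 E D h hE hD Δ m d N b hΔ f (Gc (N - b)) (c b) (IH b le_rfl)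
  have hT1' : t (d - 2, N - 1 - b) = E (h ^ m * f) * D (Gc (N - b)) -
      D (h ^ m * f) * E (Gc (N - b)) := by
    simp only [ht]
    rw [show d - 2 + 1 = d - 1 by omega, show N - 1 - b + 1 = N - b by omega, hFs]
  rw [← hT1'] at hT1
  have e1 := aux_E_pow E h hE d 1
  have e2 := aux_D_pow D h hD d 1
  simp only [mul_one, Derivation.map_one_eq_zero, mul_zero, zero_add] at e1 e2
  have hT0 : t (d - 1, N - 1 - (b + 1)) = E (h ^ d) * D (Gc (N - (b + 1))) := by
    simp only [ht]
    rw [show d - 1 + 1 = d by omega, show N - 1 - (b + 1) + 1 = N - (b + 1) by omega, hFd, e2]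
    ring
  have e4 := aux_D_pow D h hD (Δ * (b + 1)) (Gc (N - (b + 1)))
  have hDf : D (algebraMap ℂ R (c (b + 1)) * f ^ (b + 1) * h ^ N) =
      h ^ N * (algebraMap ℂ R (c (b + 1)) * ((b + 1) * f ^ b * D f)) := by
    rw [mul_comm, aux_D_pow D h hD]
    simp [Derivation.leibniz, Derivation.leibniz_pow]
    left; left; ring
  have hc' : algebraMap ℂ R (c (b + 1)) * (d * (b + 1)) = (N - d * b) * algebraMap ℂ R (c b) := by
    have := congrArg (algebraMap ℂ R) hc
    simpa using this
  have hdu : h ^ d * h ^ (N + 1) ∣ h ^ d * ((d : R) * D (h ^ (Δ * (b + 1)) * Gc (N - (b + 1)) -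
      algebraMap ℂ R (c (b + 1)) * f ^ (b + 1) * h ^ N)) := by
    have := (hT1.add hrest).neg_right
    rw [← pow_add, ← add_assoc]
    convert this using 1
    rw [map_sub, hDf, e4]
    rw [hT0] at h1
    linear_combination (h ^ (Δ * (b + 1) + 1)) * h1 - h ^ (Δ * (b + 1)) * D (Gc (N - (b + 1))) * e1
      - h ^ (d + N) * f ^ b * D f * hc'
  have hdu2 := (mul_dvd_mul_iff_left (pow_ne_zero d hh)).mp hdu
  have hd0 : (d : ℂ) ≠ 0 := by exact_mod_cast (by omega : d ≠ 0)
  have := hdu2.mul_left (algebraMap ℂ R (d : ℂ)⁻¹)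
  rwa [← mul_assoc, ← map_natCast (algebraMap ℂ R) d, ← map_mul, inv_mul_cancel₀ hd0, map_one,
    one_mul] at this
end abstr

/-- uniqueness from Euler's identity -/
lemma aux_euler {n : ℕ} (E : Derivation ℂ (MvPolynomial (Fin n) ℂ) (MvPolynomial (Fin n) ℂ))
    (h u : MvPolynomial (Fin n) ℂ) (hE : E h = 1) (hh : h.IsHomogeneous 1) (e N : ℕ)
    (hu : u.IsHomogeneous e) (heN : N < e)
    (hD : ∀ q, h ^ (N + 1) ∣ pderiv q u - pderiv q h * E u) : h ^ (N + 1) ∣ u := by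
  have key : ∀ j ≤ N + 1, h ^ j ∣ u := by
    intro j
    induction j with
    | zero => simp
    | succ j ih =>
      intro hj
      obtain ⟨v, hv⟩ := ih (by omega)
      have h1 : h ^ (j + 1) ∣ ∑ q, X q * (pderiv q u - pderiv q h * E u) :=
        Finset.dvd_sum fun q _ => ((pow_dvd_pow h hj).trans (hD q)).mul_left _
      have h2 : ∑ q, X q * (pderiv q u - pderiv q h * E u) = (e : MvPolynomial (Fin n) ℂ) * u - h * E u := by
        have a1 := hu.sum_X_mul_pderiv
        have a2 := hh.sum_X_mul_pderiv
        simp only [one_smul, nsmul_eq_mul] at a1 a2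
        simp only [mul_sub, Finset.sum_sub_distrib, ← mul_assoc, ← Finset.sum_mul]
        rw [a1, a2]
      rw [h2] at h1
      have h3 := aux_E_pow E h hE j v
      rw [← hv] at h3
      have h4 : h ^ (j + 1) ∣ ((e : MvPolynomial (Fin n) ℂ) - j) * u := by
        have := h1.add (Dvd.intro (E v) rfl : h ^ (j + 1) ∣ h ^ (j + 1) * E v)
        convert this using 1
        rw [h3]; ring
      have hd0 : ((e : ℂ) - j) ≠ 0 := by
        rw [sub_ne_zero]; exact_mod_cast (by omega : e ≠ j)
      have := h4.mul_left (C ((e : ℂ) - j)⁻¹)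
      rwa [← mul_assoc, ← map_natCast (C : ℂ →+* MvPolynomial (Fin n) ℂ) e,
        ← map_natCast (C : ℂ →+* MvPolynomial (Fin n) ℂ) j, ← map_sub, ← map_mul,
        inv_mul_cancel₀ hd0, map_one, one_mul] at this
  exact key _ le_rfl

lemma aux_homog_factor {σ : Type*} (P Q h : MvPolynomial σ ℂ) (hh : h.IsHomogeneous 1) (e j : ℕ)
    (hP : P.IsHomogeneous (e + j)) (hPQ : P = Q * h ^ j) :
    ∃ Q' : MvPolynomial σ ℂ, Q'.IsHomogeneous e ∧ P = Q' * h ^ j := by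
  refine ⟨homogeneousComponent e Q, homogeneousComponent_isHomogeneous _ _, ?_⟩
  have hg : (h ^ j).IsHomogeneous j := by simpa using hh.pow j
  rw [← aux_comp_mul_homog Q _ e j hg, ← hPQ, homogeneousComponent_eq_self hP]

noncomputable def auxC (d N : ℕ) (a : ℂ) : ℕ → ℂ
  | 0 => a
  | b + 1 => (N - d * b) * auxC d N a b / (d * (b + 1))

lemma auxC_ne (d N : ℕ) (a : ℂ) (ha : a ≠ 0) (hd : 2 ≤ d) (hNd : ¬ d ∣ N) (b : ℕ) :
    auxC d N a b ≠ 0 := by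
  induction b with
  | zero => exact ha
  | succ b ih =>
    have h1 : (N : ℂ) - d * b ≠ 0 := by
      rw [sub_ne_zero]
      intro h
      exact hNd ⟨b, by exact_mod_cast h⟩
    have h2 : (d : ℂ) ≠ 0 := by exact_mod_cast (by omega : d ≠ 0)
    have h3 : (b : ℂ) + 1 ≠ 0 := by exact_mod_cast (by omega : b + 1 ≠ 0)
    simp only [auxC]
    exact div_ne_zero (mul_ne_zero h1 ih) (mul_ne_zero h2 h3)

theorem stmt_10 {n : ℕ} (F G h : MvPolynomial (Fin n) ℂ) (d N s : ℕ) (aN : ℂ)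
    (hd : 2 ≤ d) (hdN : d ≤ N) (hs : s = d - 1)
    (hFdeg : F.totalDegree = d) (hGdeg : G.totalDegree = N)
    (hF0 : MvPolynomial.coeff 0 F = 0) (hG0 : MvPolynomial.coeff 0 G = 0)
    (hh : h.IsHomogeneous 1)
    (hFd : homogeneousComponent d F = h ^ d)
    (haN : aN ≠ 0) (hGN : homogeneousComponent N G = aN • h ^ N)
    (hNd : ¬ d ∣ N) (k : ℕ) (hk : 2 * k < d)
    (i : ℕ) (hi : 1 ≤ i) (hiN : (i : ℚ) < ((s : ℚ) - k) / ((d : ℚ) - k) * N)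
    (hdeg : PoissonDegLT F G ((d : ℤ) + i)) :
    ∃ Ft : MvPolynomial (Fin n) ℂ, Ft.IsHomogeneous (s - k - 1) ∧
      homogeneousComponent s F = Ft * h ^ (k + 1) := by
  have hFs := homogeneousComponent_isHomogeneous s F
  by_cases hdvd : h ^ (k + 1) ∣ homogeneousComponent s F
  · obtain ⟨Q, hQ⟩ := hdvd
    refine aux_homog_factor _ Q h hh (s - k - 1) (k + 1) ?_ (by rw [hQ, mul_comm])
    rwa [show s - k - 1 + (k + 1) = s by omega]
  exfalso
  -- numeric inequality
  have hnum : N < (d - k) * (N - i) ∧ i < N := by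
    have hdk : (0 : ℚ) < (d : ℚ) - k := by
      rw [sub_pos]; exact_mod_cast (by omega : k < d)
    have hs' : (s : ℚ) = d - 1 := by
      rw [hs, Nat.cast_sub (by omega)]; simp
    rw [div_mul_eq_mul_div, lt_div_iff₀ hdk, hs'] at hiN
    have hNpos : (0 : ℚ) < N := by exact_mod_cast (by omega : 0 < N)
    have hiN' : i < N := by
      by_contra hcon
      have : (N : ℚ) ≤ i := by exact_mod_cast (by omega : N ≤ i)
      nlinarith
    refine ⟨?_, hiN'⟩
    have : (N : ℚ) < ((d - k : ℕ) : ℚ) * ((N - i : ℕ) : ℚ) := by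
      rw [Nat.cast_sub (by omega), Nat.cast_sub (by omega)]
      nlinarith
    exact_mod_cast this
  -- order of `h` in `F_s`
  obtain ⟨f', hf', hnd'⟩ := FiniteMultiplicity.exists_eq_pow_mul_and_not_dvd
    (show FiniteMultiplicity h (homogeneousComponent s F) from ⟨k, hdvd⟩)
  set m := multiplicity h (homogeneousComponent s F) with hm
  have hmk : m ≤ k := by
    by_contra hcon
    exact hdvd ((pow_dvd_pow h (by omega)).trans (Dvd.intro f' hf'.symm))
  clear_value m
  obtain ⟨f, hfhom, hf⟩ := aux_homog_factor _ f' h hh (s - m) m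
    (by rwa [show s - m + m = s by omega]) (by rw [hf', mul_comm])
  -- h nonzero
  have hh0 : h ≠ 0 := by
    rintro rfl
    have hFne : F ≠ 0 := by
      rintro rfl
      simp at hFdeg
      omega
    obtain ⟨μ, hμ, hμd⟩ := Finset.exists_mem_eq_sup F.support (support_nonempty.mpr hFne)
      (fun v => v.degree)
    have hμ' : μ.degree = d := by
      rw [← hμd, ← hFdeg]
      simp only [totalDegree, Finsupp.degree, Finsupp.sum]
      rfl
    have h1 := congrArg (coeff μ) hFd
    rw [coeff_homogeneousComponent, if_pos hμ', zero_pow (by omega), coeff_zero] at h1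
    exact mem_support_iff.mp hμ h1
  have hnd : ¬ h ∣ f := by
    have : f = f' := by
      apply mul_right_cancel₀ (pow_ne_zero m hh0)
      rw [← hf, hf', mul_comm]
    rwa [this]
  have hirr : Prime h := by
    rw [← irreducible_iff_prime]
    apply irreducible_of_totalDegree_eq_one (hh.totalDegree hh0)
    intro x hx
    rw [isUnit_iff_ne_zero]
    rintro rfl
    apply hh0
    ext v
    simpa using hx v
  -- a coordinate with nonzero derivative of h
  obtain ⟨p, hp⟩ : ∃ p, pderiv p h ≠ 0 := by
    by_contra hcon
    push Not at hcon
    have := hh.sum_X_mul_pderiv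
    simp [hcon] at this
    exact hh0 this.symm
  obtain ⟨c, hc⟩ : ∃ c, pderiv p h = C c := by
    have := hh.pderiv (i := p)
    rw [← totalDegree_zero_iff_isHomogeneous, totalDegree_eq_zero_iff_eq_C] at this
    exact ⟨_, this⟩
  have hc0 : c ≠ 0 := by
    rintro rfl
    exact hp (by simp [hc])
  set E : Derivation ℂ (MvPolynomial (Fin n) ℂ) (MvPolynomial (Fin n) ℂ) := c⁻¹ • pderiv p with hEdef
  have hE : E h = 1 := by
    rw [hEdef, Derivation.smul_apply, hc, smul_eq_C_mul, ← C_mul, inv_mul_cancel₀ hc0, C_1]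
  set D : Fin n → Derivation ℂ (MvPolynomial (Fin n) ℂ) (MvPolynomial (Fin n) ℂ) :=
    fun q => pderiv q - (pderiv q h) • E with hDdef
  have hDapp : ∀ q u, D q u = pderiv q u - pderiv q h * E u := by
    intro q u; simp [hDdef]
  have hD : ∀ q, D q h = 0 := by
    intro q; rw [hDapp, hE]; ring
  set Fc : ℕ → MvPolynomial (Fin n) ℂ := fun j => homogeneousComponent j F with hFc
  set Gc : ℕ → MvPolynomial (Fin n) ℂ := fun j => homogeneousComponent j G with hGc
  have hsum : ∀ q l M, l ≤ N - i → M + l + 2 = d + N →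
      ∑ x ∈ Finset.HasAntidiagonal.antidiagonal M,
      (E (Fc (x.1 + 1)) * D q (Gc (x.2 + 1)) - D q (Fc (x.1 + 1)) * E (Gc (x.2 + 1))) = 0 := by
    intro q l M hl hM
    have hcomp : homogeneousComponent M
        (pderiv p F * pderiv q G - pderiv q F * pderiv p G) = 0 := by
      rcases hdeg p q with h0 | h0
      · rw [h0, map_zero]
      · apply homogeneousComponent_eq_zero
        omega
    rw [map_sub, aux_comp_mul, aux_comp_mul, ← Finset.sum_sub_distrib] at hcomp
    simp only [aux_comp_pderiv] at hcomp
    have := congrArg (fun z => C c⁻¹ * z) hcomp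
    simp only [mul_zero, Finset.mul_sum] at this
    rw [← this]
    apply Finset.sum_congr rfl
    intro x _
    simp only [hDapp, hFc, hGc]
    simp only [hEdef, Derivation.smul_apply, smul_eq_C_mul]
    ring
  have main : ∀ l, l ≤ N - i → h ^ (N + 1) ∣
      h ^ ((d - m) * l) * Gc (N - l) -
        algebraMap ℂ (MvPolynomial (Fin n) ℂ) (auxC d N aN l) * f ^ l * h ^ N := by
    intro l
    induction l using Nat.strong_induction_on with
    | _ l ih =>
    intro hl
    rcases l with _ | b
    · simp only [hGc, auxC, mul_zero, pow_zero, one_mul, Nat.sub_zero, hGN, mul_one,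
        algebraMap_eq, smul_eq_C_mul, sub_self, dvd_zero]
    · refine aux_euler E h _ hE hh (N + (d - m - 1) * (b + 1)) N ?_ ?_ ?_
      · apply IsHomogeneous.sub
        · have h1 := hh.pow ((d - m) * (b + 1))
          have h2 := h1.mul (homogeneousComponent_isHomogeneous (N - (b + 1)) G)
          suffices hdeg' : N + (d - m - 1) * (b + 1) =
              1 * ((d - m) * (b + 1)) + (N - (b + 1)) by
            rw [hdeg']; exact h2
          obtain ⟨z, hz⟩ : ∃ z, d - m = z + 1 := ⟨d - m - 1, by omega⟩
          obtain ⟨w, hw⟩ : ∃ w, N = w + (b + 1) := ⟨N - (b + 1), by omega⟩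
          rw [hz, hw]
          simp only [Nat.add_sub_cancel]
          ring
        · have h1 := ((hfhom.pow (b + 1)).C_mul (auxC d N aN (b + 1))).mul (hh.pow N)
          have hdeg' : N + (d - m - 1) * (b + 1) = (s - m) * (b + 1) + 1 * N := by
            rw [show d - m - 1 = s - m by omega]; ring
          rw [hdeg']; exact h1
      · have : 0 < (d - m - 1) * (b + 1) := Nat.mul_pos (by omega) (by omega)
        omega
      · intro q
        rw [← hDapp]
        refine aux_step E (D q) h hE (hD q) hh0 Fc Gc (d - m) m d N b (d + N - 2 - (b + 1)) hd
          (by omega) (by omega) f (auxC d N aN) hFd ?_ ?_ ?_ (by omega) (by omega) (by omega) ?_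
          (hsum q (b + 1) _ hl (by omega)) ?_
        · rw [← hs, mul_comm, ← hf]
        · intro j hj
          exact homogeneousComponent_eq_zero _ _ (by omega)
        · intro j hj
          exact homogeneousComponent_eq_zero _ _ (by omega)
        · have h2 : (d : ℂ) ≠ 0 := by exact_mod_cast (by omega : d ≠ 0)
          have h3 : (b : ℂ) + 1 ≠ 0 := by exact_mod_cast (by omega : b + 1 ≠ 0)
          simp only [auxC]
          field_simp
        · intro b' hb'
          exact ih b' (by omega) (by omega)
  have hfin := main (N - i) le_rfl
  have hlt : N + 1 ≤ (d - m) * (N - i) := by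
    have : (d - k) * (N - i) ≤ (d - m) * (N - i) := Nat.mul_le_mul_right _ (by omega)
    omega
  rw [dvd_sub_right ((pow_dvd_pow h hlt).mul_right _), pow_succ', mul_dvd_mul_iff_right (pow_ne_zero N hh0)] at hfin
  rcases hirr.dvd_or_dvd hfin with h1 | h1
  · have hu : IsUnit (algebraMap ℂ (MvPolynomial (Fin n) ℂ) (auxC d N aN (N - i))) :=
      (IsUnit.mk0 _ (auxC_ne d N aN haN hd hNd _)).map _
    exact hirr.not_isUnit (isUnit_of_dvd_unit h1 hu)
  · exact hnd (hirr.dvd_of_dvd_pow h1)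
end

section
/- Let d, N, t be positive integers with t dividing gcd(d,N), s = d−1 ≥ 1, let k ∈ ℕ satisfy d > 2kt, and let j be an integer with 1 ≤ j < N. Then the minimum of α₀ + k·α_s over all tuples (α₀,α₁,…,α_s) ∈ Z^{(t)}_{j,N,d} equals (1/t)·((d−kt)·j − (s−kt)·N), and this minimum is attained at exactly one point, namely ((d·j − s·N)/t, 0, …, 0, N−j) (with N−j in the last coordinate). -/
/-- The set `Z^{(t)}_{j,N,d}` of multi-indices `(α₀,α₁,…,α_s) ∈ ℤ × ℕ^s` (here `s = d-1`,
and `α.2 l` represents `α_{l+1}`) with `tα₀ + α₁ + 2α₂ + ⋯ + sα_s = j` and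
`tα₀ + d(α₁ + ⋯ + α_s) ≤ N`. -/
def ZsetT (s : ℕ) (j N d t : ℤ) : Set (ℤ × (Fin s → ℕ)) :=
  {α | t * α.1 + ∑ l : Fin s, ((l : ℤ) + 1) * (α.2 l : ℤ) = j ∧
       t * α.1 + d * ∑ l : Fin s, (α.2 l : ℤ) ≤ N}

theorem aux_sum (s d : ℕ) (c : ℤ) (hsd : d = s + 1) (hs1 : 1 ≤ s) (hc0 : 0 ≤ c) (hc : 2 * c < d)
    (a : Fin s → ℕ) :
    (∑ l : Fin s, ((l : ℤ) + 1) * (a l : ℤ)) - c * a ⟨s - 1, by omega⟩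
      + ((∑ l : Fin s, (a l : ℤ)) - a ⟨s - 1, by omega⟩)
      ≤ ((s : ℤ) - c) * (d * (∑ l : Fin s, (a l : ℤ)) - ∑ l : Fin s, ((l : ℤ) + 1) * (a l : ℤ)) := by
  have h1 : ∀ f : Fin s → ℤ, f ⟨s - 1, by omega⟩
      = ∑ l : Fin s, if l = ⟨s - 1, by omega⟩ then f l else 0 := by
    intro f; simp
  rw [h1 (fun l => (a l : ℤ))]
  simp only [Finset.mul_sum, ← Finset.sum_sub_distrib, ← Finset.sum_add_distrib]
  apply Finset.sum_le_sum
  intro l _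
  have hl := l.2
  subst hsd
  push_cast at hc ⊢
  have ha : (0 : ℤ) ≤ a l := by positivity
  split_ifs with h
  · have : ((l : ℕ) : ℤ) = s - 1 := by rw [h]; simp; omega
    rw [this]; apply le_of_eq; ring
  · have hl2 : (l : ℕ) ≠ s - 1 := fun h' => h (Fin.ext h')
    have hl3 : ((l : ℕ) : ℤ) + 2 ≤ s := by omega
    have h3 : (l : ℤ) + 2 ≤ ((s : ℤ) - c) * (s - l) := by
      nlinarith [mul_nonneg (show (0 : ℤ) ≤ s - c by omega) (show (0 : ℤ) ≤ s - l - 2 by omega)]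
    nlinarith [mul_le_mul_of_nonneg_right h3 ha]

theorem stmt_11 (d N t j k : ℕ) (hd : 2 ≤ d) (ht : 0 < t)
    (htdvd : t ∣ Nat.gcd d N) (s : ℕ) (hs : s = d - 1) (hs1 : 1 ≤ s)
    (hk : 2 * k * t < d) (hj : 1 ≤ j) (hjN : j < N) :
    (∀ α ∈ ZsetT s j N d t,
        (((d : ℤ) - k * t) * j - ((s : ℤ) - k * t) * N) / t
          ≤ α.1 + k * α.2 ⟨s - 1, by omega⟩) ∧
    ((((d : ℤ) * j - s * N) / t,
        fun l : Fin s => if (l : ℕ) = s - 1 then N - j else 0) ∈ ZsetT s j N d t) ∧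
    (((d : ℤ) * j - s * N) / t + k * ((N : ℤ) - j)
        = (((d : ℤ) - k * t) * j - ((s : ℤ) - k * t) * N) / t) ∧
    (∀ α ∈ ZsetT s j N d t,
      α.1 + k * α.2 ⟨s - 1, by omega⟩
          = (((d : ℤ) - k * t) * j - ((s : ℤ) - k * t) * N) / t →
      α = (((d : ℤ) * j - s * N) / t,
            fun l : Fin s => if (l : ℕ) = s - 1 then N - j else 0)) := by
  obtain ⟨d', hd'⟩ := htdvd.trans (Nat.gcd_dvd_left d N)
  obtain ⟨N', hN'⟩ := htdvd.trans (Nat.gcd_dvd_right d N)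
  have hsd : d = s + 1 := by omega
  have hsdz : (d : ℤ) = s + 1 := by exact_mod_cast hsd
  have htz : (0 : ℤ) < t := by exact_mod_cast ht
  have hdz : (d : ℤ) = t * d' := by exact_mod_cast hd'
  have hNz : (N : ℤ) = t * N' := by exact_mod_cast hN'
  have hjz : (j : ℤ) < N := by exact_mod_cast hjN
  have hkz : 2 * ((k : ℤ) * t) < d := by
    have : 2 * (k : ℤ) * t < d := by exact_mod_cast hk
    linarith
  have hk0 : (0 : ℤ) ≤ (k : ℤ) * t := by positivity
  have hsc : (0 : ℤ) < s - k * t := by omega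
  have e1 : ((d : ℤ) * j - s * N) / t = d' * j - s * N' := by
    apply Int.ediv_eq_of_eq_mul_right htz.ne'
    rw [hNz, hdz]; ring
  have e2 : (((d : ℤ) - k * t) * j - ((s : ℤ) - k * t) * N) / t
      = d' * j - s * N' + k * ((N : ℤ) - j) := by
    apply Int.ediv_eq_of_eq_mul_right htz.ne'
    rw [hNz, hdz]; ring
  have e3 : (t : ℤ) * (d' * j - s * N') = j - s * (N - j) := by
    have : (t : ℤ) * (d' * j - s * N') = d * j - s * N := by rw [hNz, hdz]; ring
    rw [this, hsdz]; ring
  rw [e1, e2]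
  refine ⟨?_, ?_, rfl, ?_⟩
  · rintro ⟨a0, a⟩ ⟨h1, h2⟩
    have key := aux_sum s d (k * t) hsd hs1 hk0 hkz a
    have hB : (a ⟨s - 1, by omega⟩ : ℤ) ≤ ∑ l : Fin s, (a l : ℤ) :=
      Finset.single_le_sum (f := fun l => (a l : ℤ)) (fun _ _ => by positivity) (Finset.mem_univ _)
    dsimp only at h1 h2 ⊢
    generalize (∑ l : Fin s, ((l : ℤ) + 1) * (a l : ℤ)) = A at *
    generalize (∑ l : Fin s, (a l : ℤ)) = B at *
    generalize (a ⟨s - 1, by omega⟩ : ℤ) = x at *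
    have h3 : ((s : ℤ) - k * t) * (d * B - A) ≤ (s - k * t) * (N - j) :=
      mul_le_mul_of_nonneg_left (by linarith) hsc.le
    refine le_of_mul_le_mul_left ?_ htz
    linarith
  · have hif : ∀ l : Fin s, ((l : ℕ) = s - 1) ↔ l = ⟨s - 1, by omega⟩ :=
      fun l => by rw [Fin.ext_iff]
    have hc : ((s - 1 : ℕ) : ℤ) = s - 1 := by omega
    have hc2 : ((N - j : ℕ) : ℤ) = N - j := by omega
    constructor
    · simp only [hif, Nat.cast_ite, Nat.cast_zero, mul_ite, mul_zero, Finset.sum_ite_eq',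
        Finset.mem_univ, if_true, hc, hc2]
      rw [e3]; ring
    · simp only [hif, Nat.cast_ite, Nat.cast_zero, Finset.sum_ite_eq',
        Finset.mem_univ, if_true, hc2]
      rw [e3, hsdz]; apply le_of_eq; ring
  · rintro ⟨a0, a⟩ ⟨h1, h2⟩ heq
    have key := aux_sum s d (k * t) hsd hs1 hk0 hkz a
    have hB : (a ⟨s - 1, by omega⟩ : ℤ) ≤ ∑ l : Fin s, (a l : ℤ) :=
      Finset.single_le_sum (f := fun l => (a l : ℤ)) (fun _ _ => by positivity) (Finset.mem_univ _)
    dsimp only at h1 h2 heq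
    have heq' := congrArg (fun z : ℤ => (t : ℤ) * z) heq
    have hz : ∀ l : Fin s, l ≠ ⟨s - 1, by omega⟩ →
        (a ⟨s - 1, by omega⟩ : ℤ) + a l ≤ ∑ l : Fin s, (a l : ℤ) := by
      intro l hl
      rw [← Finset.sum_pair (f := fun l => (a l : ℤ)) hl.symm]
      exact Finset.sum_le_sum_of_subset_of_nonneg (Finset.subset_univ _)
        (fun _ _ _ => by positivity)
    have h3 : ((s : ℤ) - k * t) * (d * (∑ l : Fin s, (a l : ℤ)) - ∑ l : Fin s, ((l : ℤ) + 1) * (a l : ℤ)) ≤ (s - k * t) * (N - j) :=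
      mul_le_mul_of_nonneg_left (by linarith) hsc.le
    have hBx : ∑ l : Fin s, (a l : ℤ) = a ⟨s - 1, by omega⟩ := by linarith
    have hzero : ∀ l : Fin s, l ≠ ⟨s - 1, by omega⟩ → a l = 0 := by
      intro l hl
      have := hz l hl
      omega
    have hA : (∑ l : Fin s, ((l : ℤ) + 1) * (a l : ℤ)) = s * a ⟨s - 1, by omega⟩ := by
      rw [Finset.sum_eq_single ⟨s - 1, by omega⟩]
      · have hc : ((s - 1 : ℕ) : ℤ) = s - 1 := by omega
        simp only [hc]; ring
      · intro l _ hl; rw [hzero l hl]; simp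
      · simp
    rw [hA] at h1
    have hx : (a ⟨s - 1, by omega⟩ : ℤ) = N - j := by
      have : ((s : ℤ) - k * t) * a ⟨s - 1, by omega⟩ = (s - k * t) * (N - j) := by linarith
      exact mul_left_cancel₀ hsc.ne' this
    refine Prod.ext ?_ ?_
    · dsimp only
      rw [hx] at heq; linarith
    · funext l
      dsimp only
      split_ifs with h
      · have : l = ⟨s - 1, by omega⟩ := Fin.ext h
        rw [this]; omega
      · exact hzero l (fun h' => h (by rw [h']))
end
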